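/- arXiv:1109.2161 — 3 statements merged into one kernel-verified Lean document; each statement's English description precedes it below -/
import Mathlib

section
/- Let n ≥ 1, let Φ ∈ COMFORT(Δ_n), and let b ∈ BOU_n. Then for every index i ∈ {0,…,n}: Φ(b)_i = 0 if and only if b_i = 0. In particular, if a permutation ϑ sorts the components of b so that b_{ϑ(0)} = … = b_{ϑ(q)} = 0 < b_{ϑ(q+1)}, then c := Φ(b) satisfies c_{ϑ(0)} = … = c_{ϑ(q)} = 0 < c_{ϑ(q+1)}. -/
open scoped BigOperators

noncomputable section

/-- `Spx k` is the standard simplex on `k` coordinates, i.e. the standard simplex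
`Δ_{k-1}` of the paper, as a subspace of `ℝ^k`. -/
abbrev Spx (k : ℕ) : Type := {x : Fin k → ℝ // x ∈ stdSimplex ℝ (Fin k)}

lemma perm_mem {k : ℕ} (ϑ : Equiv.Perm (Fin k)) {x : Fin k → ℝ}
    (hx : x ∈ stdSimplex ℝ (Fin k)) :
    (fun i => x (ϑ i)) ∈ stdSimplex ℝ (Fin k) :=
  ⟨fun i => hx.1 (ϑ i), (Equiv.sum_comp ϑ x).trans hx.2⟩

/-- membership of `COMFORT (Δ_n)`: a self-homeomorphism of the standard simplex which
(i) respects coordinate permutations and (ii) keeps the order. -/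
structure IsComfort {n : ℕ} (F : Spx (n+1) ≃ₜ Spx (n+1)) : Prop where
  perm : ∀ (ϑ : Equiv.Perm (Fin (n+1))) (x : Spx (n+1)),
      ((F ⟨fun i => x.1 (ϑ i), perm_mem ϑ x.2⟩ : Spx (n+1)) : Fin (n+1) → ℝ)
        = fun i => (F x).1 (ϑ i)
  mono : ∀ (x : Spx (n+1)) (i j : Fin (n+1)), x.1 i ≤ x.1 j → (F x).1 i ≤ (F x).1 j

/-- the `α`-cross `♣_{n,α}` of `Δ_n`. -/
def cross (n : ℕ) (α : ℝ) : Set (Spx (n+1)) := {x | ∃ j, x.1 j = α}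

/-- the boundary `BOU_n = ♣_{n,0}` of `Δ_n`. -/
def bou (n : ℕ) : Set (Spx (n+1)) := cross n 0

/-- the barycenter `Center_n` of `Δ_n`. -/
def center (n : ℕ) : Spx (n+1) :=
  ⟨fun _ => 1/((n:ℝ)+1), by
    constructor
    · intro i
      positivity
    · rw [Finset.sum_const, Finset.card_univ, Fintype.card_fin, nsmul_eq_mul]
      push_cast
      field_simp⟩

/-- the minimal coordinate of a point of `Δ_n`. -/
def minCoord {n : ℕ} (x : Spx (n+1)) : ℝ :=
  Finset.univ.inf' Finset.univ_nonempty x.1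

/-- the `α`-layer `Layer_{n,α}` of `Δ_n`. -/
def layer (n : ℕ) (α : ℝ) : Set (Spx (n+1)) := {x | minCoord x = α}

/-- `Sponge (Δ_n)`: the points of `Δ_n` with pairwise distinct coordinates. -/
def sponge (n : ℕ) : Set (Spx (n+1)) := {x | ∀ i j, x.1 i = x.1 j → i = j}

section Retract

open MeasureTheory Set

variable {E : Type*} [NormedAddCommGroup E]

theorem exists_polynomial_eval_eq_det [NormedSpace ℝ E] [FiniteDimensional ℝ E] (A : E →L[ℝ] E) :
    ∃ p : Polynomial ℝ, p.natDegree ≤ Module.finrank ℝ E ∧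
      ∀ t : ℝ, p.eval t = (1 + t • A).det := by
  let b := Module.finBasis ℝ E
  let M := LinearMap.toMatrix b b (A : E →ₗ[ℝ] E)
  refine ⟨Matrix.det ((Polynomial.X : Polynomial ℝ) • M.map Polynomial.C +
    (1 : Matrix _ _ ℝ).map Polynomial.C), ?_, fun t => ?_⟩
  · simpa using Polynomial.natDegree_det_X_add_C_le M 1
  · rw [← Polynomial.coe_evalRingHom, RingHom.map_det, ContinuousLinearMap.det, ← LinearMap.det_toMatrix b]
    congr 1
    ext i j
    by_cases hij : i = j <;> simp [M, LinearMap.toMatrix_one, hij] <;> ring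

theorem integral_det_one_add_eq_of_forall_small [NormedSpace ℝ E] [FiniteDimensional ℝ E]
    [MeasurableSpace E] [BorelSpace E] {μ : Measure E} [IsFiniteMeasureOnCompacts μ]
    {s : Set E} (hs : IsCompact s) {A : E → E →L[ℝ] E} (hA : Continuous A) {c δ : ℝ} (hδ : 0 < δ)
    (h : ∀ t, 0 < t → t < δ → ∫ x in s, (1 + t • A x).det ∂μ = c) (t : ℝ) :
    ∫ x in s, (1 + t • A x).det ∂μ = c := by
  choose p hp hpe using fun x => exists_polynomial_eval_eq_det (A x)
  let d := Module.finrank ℝ E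
  let S := Finset.range (d + 1)
  let v : ℕ → ℝ := fun i => δ / (i + 2)
  have hv0 (i : ℕ) : 0 < v i := by positivity
  have hv1 (i : ℕ) : v i < δ := by
    have : (0 : ℝ) ≤ i := i.cast_nonneg
    exact (div_lt_iff₀ (by positivity)).2 (by nlinarith)
  have hv : InjOn v S := by
    intro i _ j _ hij
    have h1 : δ / ((i : ℝ) + 2) = δ / (j + 2) := hij
    rw [div_eq_div_iff (by positivity) (by positivity)] at h1
    have h2 := mul_left_cancel₀ hδ.ne' h1
    exact_mod_cast (add_right_cancel h2).symm
  have interp (f : Polynomial ℝ) (hf : f.natDegree ≤ d) :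
      f.eval t = ∑ i ∈ S, f.eval (v i) * (Lagrange.basis S v i).eval t := by
    have hdeg : f.degree < S.card := by
      refine (Polynomial.degree_le_of_natDegree_le hf).trans_lt ?_
      simp only [S, Finset.card_range]
      exact_mod_cast Nat.lt_succ_self d
    conv_lhs => rw [Lagrange.eq_interpolate hv hdeg]
    simp [Lagrange.interpolate_apply, Polynomial.eval_finsetSum]
  have hsum : ∑ i ∈ S, (Lagrange.basis S v i).eval t = 1 := by
    simpa using (interp 1 (by simp)).symm
  have hint (i : ℕ) : IntegrableOn (fun x => (1 + v i • A x).det) s μ := by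
    refine ContinuousOn.integrableOn_compact hs (Continuous.continuousOn ?_)
    exact ContinuousLinearMap.continuous_det.comp (by fun_prop)
  calc ∫ x in s, (1 + t • A x).det ∂μ
      = ∫ x in s, ∑ i ∈ S, (1 + v i • A x).det * (Lagrange.basis S v i).eval t ∂μ := by
        congr 1
        ext x
        simp only [← hpe]
        exact interp _ (hp x)
    _ = ∑ i ∈ S, c * (Lagrange.basis S v i).eval t := by
        rw [integral_finsetSum _ fun i _ => (hint i).mul_const _]
        refine Finset.sum_congr rfl fun i _ => ?_
        rw [integral_mul_const, h _ (hv0 i) (hv1 i)]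
    _ = c := by rw [← Finset.mul_sum, hsum, mul_one]

theorem lipschitzWith_indicator_closedBall [NormedSpace ℝ E] {w : E → E} {ρ : ℝ} {K : NNReal}
    (hw : LipschitzOnWith K w (Metric.closedBall 0 ρ)) (hw0 : ∀ x, ‖x‖ = ρ → w x = 0) :
    LipschitzWith K ((Metric.closedBall (0 : E) ρ).indicator w) := by
  have cross (x y : E) (hx : ‖x‖ ≤ ρ) (hy : ρ < ‖y‖) : ‖w x‖ ≤ K * dist x y := by
    obtain ⟨z, hz, hzρ⟩ : ∃ z ∈ segment ℝ x y, ‖z‖ = ρ :=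
      (convex_segment x y).isPreconnected.intermediate_value (left_mem_segment ℝ x y)
        (right_mem_segment ℝ x y) continuous_norm.continuousOn ⟨hx, hy.le⟩
    have h1 := hw.dist_le_mul x (by simpa using hx) z (by simp [hzρ])
    rw [hw0 z hzρ, dist_zero_right] at h1
    have h2 := dist_add_dist_of_mem_segment hz
    exact h1.trans (mul_le_mul_of_nonneg_left (by linarith [dist_nonneg (x := z) (y := y)]) K.2)
  refine LipschitzWith.of_dist_le_mul fun x y => ?_
  by_cases hx : ‖x‖ ≤ ρ <;> by_cases hy : ‖y‖ ≤ ρ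
  · simpa [indicator, hx, hy] using hw.dist_le_mul x (by simpa using hx) y (by simpa using hy)
  · simpa [indicator, hx, hy] using cross x y hx (not_le.1 hy)
  · simpa [indicator, hx, hy, dist_comm] using cross y x hy (not_le.1 hx)
  · simp [indicator, hx, hy]
    positivity

theorem bijective_add_of_lipschitzWith [NormedSpace ℝ E] [CompleteSpace E] {w : E → E}
    {c : NNReal} (hw : LipschitzWith c w) (hc : c < 1) :
    Function.Bijective fun x => x + w x := by
  have happ : ApproximatesLinearOn (fun x => x + w x)
      (ContinuousLinearEquiv.refl ℝ E : E →L[ℝ] E) univ c := by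
    intro x _ y _
    have := hw.dist_le_mul x y
    rw [dist_eq_norm, dist_eq_norm] at this
    simpa [add_sub_add_comm] using this
  have hN : Subsingleton E ∨
      c < ‖((ContinuousLinearEquiv.refl ℝ E).symm : E →L[ℝ] E)‖₊⁻¹ := by
    rcases subsingleton_or_nontrivial E with h | h
    · exact Or.inl h
    · right
      have : ‖((ContinuousLinearEquiv.refl ℝ E).symm : E →L[ℝ] E)‖₊ = 1 := by
        ext
        exact ContinuousLinearMap.norm_id
      rwa [this, inv_one]
  exact ⟨injOn_univ.1 (happ.injOn hN), happ.surjective hN⟩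

theorem image_add_smul_closedBall [NormedSpace ℝ E] [CompleteSpace E] {w : E → E} {ρ : ℝ}
    {K : NNReal} (hw : LipschitzOnWith K w (Metric.closedBall 0 ρ))
    (hw0 : ∀ x, ‖x‖ = ρ → w x = 0) {t : ℝ} (ht : 0 ≤ t) (htK : t * K < 1) :
    InjOn (fun x => x + t • w x) (Metric.closedBall 0 ρ) ∧
      (fun x => x + t • w x) '' Metric.closedBall 0 ρ = Metric.closedBall 0 ρ := by
  set B := Metric.closedBall (0 : E) ρ
  set W : E → E := fun x => t • B.indicator w x
  have hW : LipschitzWith (t.toNNReal * K) W := by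
    refine LipschitzWith.of_dist_le_mul fun x y => ?_
    have := (lipschitzWith_indicator_closedBall hw hw0).dist_le_mul x y
    rw [dist_smul₀, Real.norm_of_nonneg ht, NNReal.coe_mul, Real.coe_toNNReal t ht, mul_assoc]
    exact mul_le_mul_of_nonneg_left this ht
  have hbij := bijective_add_of_lipschitzWith hW (by
    rwa [← NNReal.coe_lt_coe, NNReal.coe_mul, Real.coe_toNNReal t ht])
  have hin : ∀ x ∈ B, x + W x = x + t • w x := fun x hx => by simp [W, hx]
  have hout : ∀ x ∉ B, x + W x = x := fun x hx => by simp [W, hx]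
  refine ⟨fun x hx y hy hxy => hbij.1 ?_, Subset.antisymm ?_ fun y hy => ?_⟩
  · simpa only [hin x hx, hin y hy] using hxy
  · rintro _ ⟨x, hx, rfl⟩
    by_contra hB
    simp only [← hin x hx] at hB
    exact hB ((hbij.1 (hout _ hB) : x + W x = x).symm ▸ hx)
  · obtain ⟨x, rfl⟩ := hbij.2 y
    have hx : x ∈ B := by
      by_contra hB
      simp only [hout x hB] at hy
      exact hB hy
    exact ⟨x, hx, (hin x hx).symm⟩

theorem integral_det_one_add_fderiv [NormedSpace ℝ E] [FiniteDimensional ℝ E]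
    [MeasurableSpace E] [BorelSpace E] (μ : Measure E) [μ.IsAddHaarMeasure] {w : E → E}
    (hw : ContDiff ℝ 1 w) {ρ : ℝ} (hw0 : ∀ x, ‖x‖ = ρ → w x = 0) :
    ∫ x in Metric.closedBall 0 ρ, (1 + fderiv ℝ w x).det ∂μ = μ.real (Metric.closedBall 0 ρ) := by
  have hB := isCompact_closedBall (0 : E) ρ
  have hcont : Continuous (fderiv ℝ w) := hw.continuous_fderiv one_ne_zero
  obtain ⟨C, hC⟩ := hB.exists_bound_of_continuousOn hcont.continuousOn
  set K : NNReal := C.toNNReal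
  have hK : ∀ x ∈ Metric.closedBall (0 : E) ρ, ‖fderiv ℝ w x‖ ≤ K := fun x hx =>
    (hC x hx).trans (Real.le_coe_toNNReal C)
  have hlip : LipschitzOnWith K w (Metric.closedBall 0 ρ) :=
    (convex_closedBall (0 : E) ρ).lipschitzOnWith_of_nnnorm_fderiv_le
      (fun x _ => (hw.differentiable one_ne_zero) x) hK
  obtain ⟨ε, hε, hdet⟩ : ∃ ε > 0, ∀ A : E →L[ℝ] E, ‖A‖ < ε → 0 < (1 + A).det := by
    have hopen : IsOpen {A : E →L[ℝ] E | 0 < (1 + A).det} :=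
      isOpen_lt continuous_const (ContinuousLinearMap.continuous_det.comp (by fun_prop))
    obtain ⟨ε, hε, h⟩ := Metric.isOpen_iff.1 hopen 0 (by simp [ContinuousLinearMap.det])
    exact ⟨ε, hε, fun A hA => h (by simpa using hA)⟩
  have key := integral_det_one_add_eq_of_forall_small (μ := μ) hB hcont
    (c := μ.real (Metric.closedBall 0 ρ)) (δ := min 1 ε / (K + 1)) (by positivity) ?_ 1
  · simpa using key
  intro t ht htδ
  rw [lt_div_iff₀ (by positivity)] at htδ
  have htK : t * K < min 1 ε := by linarith
  obtain ⟨hinj, himg⟩ := image_add_smul_closedBall hlip hw0 ht.le (htK.trans_le (min_le_left _ _))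
  have hder : ∀ x ∈ Metric.closedBall (0 : E) ρ, HasFDerivWithinAt (fun x => x + t • w x)
      (1 + t • fderiv ℝ w x) (Metric.closedBall 0 ρ) x := fun x _ =>
    ((hasFDerivAt_id x).add
      (((hw.differentiable one_ne_zero) x).hasFDerivAt.const_smul t)).hasFDerivWithinAt
  have hcv := integral_image_eq_integral_abs_det_fderiv_smul μ hB.measurableSet hder hinj
    fun _ => (1 : ℝ)
  rw [himg] at hcv
  rw [← mul_one (μ.real _), ← smul_eq_mul, ← setIntegral_const, hcv]
  refine setIntegral_congr_fun hB.measurableSet fun x hx => ?_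
  have : 0 < (1 + t • fderiv ℝ w x).det := hdet _ (by
    rw [norm_smul, Real.norm_of_nonneg ht.le]
    exact (mul_le_mul_of_nonneg_left (hK x hx) ht.le).trans_lt (htK.trans_le (min_le_right _ _)))
  simp [abs_of_pos this]

theorem det_fderiv_eq_zero_of_norm_eq [InnerProductSpace ℝ E] [FiniteDimensional ℝ E] {r : E → E}
    {ρ : ℝ} (hρ : 0 < ρ) (hr : Differentiable ℝ r) (hnorm : ∀ x, ‖r x‖ = ρ) (x : E) :
    (fderiv ℝ r x).det = 0 := by
  by_contra hdet
  obtain ⟨v, hv⟩ : ∃ v, fderiv ℝ r x v = r x := by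
    have hu := (LinearMap.isUnit_iff_isUnit_det _).2 (isUnit_iff_ne_zero.2 hdet)
    exact ((Module.End.isUnit_iff _).1 hu).2 (r x)
  have h1 : HasFDerivAt (fun y => ‖r y‖ ^ 2) _ x := (hr x).hasFDerivAt.norm_sq
  simp only [hnorm] at h1
  have h2 := congrArg (fun L => L v) (h1.unique (hasFDerivAt_const _ x))
  simp [hv, hnorm] at h2
  exact hρ.ne' h2

theorem exists_eq_zero_of_eq_id_of_norm_ge [InnerProductSpace ℝ E] [FiniteDimensional ℝ E]
    {f : E → E} (hf : Continuous f) {R : ℝ} (hR : ∀ x, R ≤ ‖x‖ → f x = x) : ∃ x, f x = 0 := by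
  by_contra! hne
  let _ : MeasurableSpace E := borel E
  have _ : BorelSpace E := ⟨rfl⟩
  obtain ⟨v, hv, hvε, hvs⟩ := (hf.sub continuous_id).exists_contDiff_approx 1
    (ε := fun x => ‖f x‖) hf.norm fun x => norm_pos_iff.2 (hne x)
  set g : E → E := fun x => x + v x
  have hg : ContDiff ℝ 1 g := contDiff_id.add hv
  have hg0 (x : E) : g x ≠ 0 := by
    intro h
    have h1 := hvε x
    rw [eq_neg_of_add_eq_zero_right h, dist_eq_norm] at h1
    simp [neg_sub_left] at h1
  set ρ := max R 1
  have hρ : 0 < ρ := lt_max_of_lt_right one_pos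
  have hgρ (x : E) (hx : ‖x‖ = ρ) : g x = x := by
    have : x ∉ Function.support v := fun h => hvs h (by
      simp [hR x (hx ▸ le_max_left _ _)])
    simp [g, Function.notMem_support.1 this]
  set r : E → E := fun x => (ρ / ‖g x‖) • g x
  have hr : ContDiff ℝ 1 r :=
    (contDiff_const.div (hg.norm ℝ hg0) fun x => norm_ne_zero_iff.2 (hg0 x)).smul hg
  have hrn (x : E) : ‖r x‖ = ρ := by
    rw [norm_smul, Real.norm_of_nonneg (by positivity),
      div_mul_cancel₀ _ (norm_ne_zero_iff.2 (hg0 x))]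
  have hrd := hr.differentiable one_ne_zero
  have key := integral_det_one_add_fderiv (volume : Measure E) (w := fun x => r x - x)
    (hr.sub contDiff_id) (ρ := ρ) fun x hx => by simp [r, hgρ x hx, hx, hρ.ne']
  have hfd (x : E) : (1 + fderiv ℝ (fun x => r x - x) x).det = 0 := by
    rw [fderiv_fun_sub (hrd x) differentiableAt_fun_id, fderiv_fun_id,
      ← ContinuousLinearMap.one_def, add_sub_cancel]
    exact det_fderiv_eq_zero_of_norm_eq hρ hrd hrn x
  simp only [hfd, integral_zero] at key
  have hpos : 0 < volume (Metric.closedBall (0 : E) ρ) := Metric.measure_closedBall_pos _ _ hρ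
  have := ENNReal.toReal_pos hpos.ne' measure_closedBall_lt_top.ne
  exact this.ne key

end Retract

section Simplex

open Set

variable {n : ℕ}

theorem isClosed_bou : IsClosed (bou n) := by
  have : bou n = ⋃ j : Fin (n + 1), {x : Spx (n + 1) | x.1 j = 0} := by
    ext x
    simp [bou, cross]
  rw [this]
  exact isClosed_iUnion_of_finite fun j =>
    isClosed_eq ((continuous_apply j).comp continuous_subtype_val) continuous_const

/-- The direction space of the affine hull of the standard simplex. -/
abbrev SumZero (k : ℕ) : Submodule ℝ (EuclideanSpace ℝ (Fin k)) :=
  LinearMap.ker (∑ i, (EuclideanSpace.proj i : EuclideanSpace ℝ (Fin k) →L[ℝ] ℝ)).toLinearMap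

theorem sum_eq_zero_of_mem_sumZero {k : ℕ} (v : SumZero k) : ∑ i, v.1 i = 0 := by
  obtain ⟨v, hv⟩ := v
  simpa using hv

/-- The displacement from `q` to `x`. -/
def displacement {k : ℕ} (q x : Spx k) : SumZero k :=
  ⟨WithLp.toLp 2 fun i => x.1 i - q.1 i, by simp [x.2.2, q.2.2]⟩

theorem continuous_displacement {k : ℕ} (q : Spx k) : Continuous (displacement q) := by
  exact Continuous.subtype_mk ((PiLp.continuous_toLp 2 _).comp
    (continuous_subtype_val.sub continuous_const)) _

theorem mem_stdSimplex_add {k : ℕ} (q : Spx k) (v : SumZero k) (hv : ∀ i, 0 ≤ q.1 i + v.1 i) :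
    (fun i => q.1 i + v.1 i) ∈ stdSimplex ℝ (Fin k) :=
  ⟨hv, by rw [Finset.sum_add_distrib, q.2.2, sum_eq_zero_of_mem_sumZero, add_zero]⟩

theorem surjective_of_eq_id_on_bou {G : Spx (n + 1) → Spx (n + 1)} (hG : Continuous G)
    (hbou : ∀ x ∈ bou n, G x = x) : Function.Surjective G := by
  intro q
  let E := SumZero (n + 1)
  let m : E → ℝ := fun v => Finset.univ.inf' Finset.univ_nonempty fun i => q.1 i + v.1 i
  have hm : Continuous m := Continuous.finset_inf'_apply _ fun i _ => by fun_prop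
  have hm0 (v : E) : 0 ≤ m v ↔ ∀ i, 0 ≤ q.1 i + v.1 i := by simp [m]
  let p : {v : E | 0 ≤ m v} → Spx (n + 1) := fun v =>
    ⟨_, mem_stdSimplex_add q v.1 ((hm0 _).1 v.2)⟩
  have hp : Continuous p := by fun_prop
  let g : E → E := fun v => if h : 0 ≤ m v then displacement q (G (p ⟨v, h⟩)) else 0
  have hg : ContinuousOn g {v | 0 ≤ m v} := by
    rw [continuousOn_iff_continuous_domRestrict]
    have : {v | 0 ≤ m v}.domRestrict g = fun v => displacement q (G (p v)) := by
      ext1 v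
      exact dif_pos v.2
    rw [this]
    exact (continuous_displacement q).comp (hG.comp hp)
  have hf : Continuous fun v => if 0 ≤ m v then g v else v := by
    refine continuous_if_le continuous_const hm hg continuousOn_id fun v hv => ?_
    have hpv : p ⟨v, hv.le⟩ ∈ bou n := by
      obtain ⟨i, -, hi⟩ := Finset.exists_mem_eq_inf' Finset.univ_nonempty fun i => q.1 i + v.1 i
      exact ⟨i, hi.symm.trans hv.symm⟩
    simp only [g, dif_pos hv.le, hbou _ hpv]
    ext i
    simp [displacement, p]
  obtain ⟨v, hv⟩ := exists_eq_zero_of_eq_id_of_norm_ge hf (R := n + 2) fun v hv => by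
    refine if_neg fun h => ?_
    have hmem := mem_stdSimplex_add q v ((hm0 _).1 h)
    have hi (i : Fin (n + 1)) : ‖v.1 i‖ ^ 2 ≤ 1 := by
      have h1 := (mem_Icc_of_mem_stdSimplex hmem i)
      have h2 := (mem_Icc_of_mem_stdSimplex q.2 i)
      rw [Real.norm_eq_abs, sq_abs, sq_le_one_iff_abs_le_one, abs_le]
      constructor <;> linarith [h1.1, h1.2, h2.1, h2.2]
    have hn : ‖v‖ ^ 2 ≤ n + 1 := by
      change ‖(v : EuclideanSpace ℝ (Fin (n + 1)))‖ ^ 2 ≤ n + 1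
      rw [EuclideanSpace.norm_sq_eq]
      simpa using Finset.sum_le_card_nsmul Finset.univ _ 1 fun i _ => hi i
    nlinarith
  by_cases h : 0 ≤ m v
  · simp only [if_pos h, g, dif_pos h] at hv
    refine ⟨p ⟨v, h⟩, ?_⟩
    refine Subtype.ext (funext fun i => ?_)
    have := congrArg (fun w : E => w.1 i) hv
    simpa [displacement, sub_eq_zero] using this
  · simp only [if_neg h] at hv
    exact absurd ((hm0 v).2 fun i => by simpa [hv] using q.2.1 i) h

/-- Moving `x` the fraction `s` of the way to the barycenter. -/
def moveToCenter (s : ℝ) (hs : s ∈ Icc (0 : ℝ) 1) (x : Spx (n + 1)) : Spx (n + 1) :=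
  ⟨(1 - s) • x.1 + s • (center n).1,
    convex_stdSimplex ℝ _ x.2 (center n).2 (by linarith [hs.2]) hs.1 (by ring)⟩

theorem moveToCenter_notMem_bou {s : ℝ} (hs : s ∈ Icc (0 : ℝ) 1) (hs0 : s ≠ 0)
    (x : Spx (n + 1)) : moveToCenter s hs x ∉ bou n := by
  rintro ⟨j, hj⟩
  have h1 : 0 ≤ (1 - s) * x.1 j := mul_nonneg (by linarith [hs.2]) (x.2.1 j)
  have h2 : 0 < s * (1 / ((n : ℝ) + 1)) := mul_pos (hs.1.lt_of_ne' hs0) (by positivity)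
  have h3 : (1 - s) * x.1 j + s * (1 / ((n : ℝ) + 1)) = 0 := hj
  linarith

theorem map_mem_bou (Φ : Spx (n + 1) ≃ₜ Spx (n + 1)) {b : Spx (n + 1)} (hb : b ∈ bou n) :
    Φ b ∈ bou n := by
  by_contra hq
  obtain ⟨φ, hφ0, hφ1, hφ⟩ := exists_continuous_zero_one_of_isClosed
    (isClosed_bou.preimage Φ.continuous) (isClosed_singleton (x := b))
    (disjoint_singleton_right.2 hq)
  let h : Spx (n + 1) → Spx (n + 1) := fun x => moveToCenter (φ x) (hφ x) x
  have hh : Continuous h := by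
    unfold h moveToCenter
    fun_prop
  have hfix (x : Spx (n + 1)) (hx : φ x = 0) : h x = x := by
    ext i
    simp [h, moveToCenter, hx]
  obtain ⟨x, hx⟩ := surjective_of_eq_id_on_bou (G := fun x => Φ (h (Φ.symm x)))
    (Φ.continuous.comp (hh.comp Φ.symm.continuous)) (fun x hx => by
      have : φ (Φ.symm x) = 0 := hφ0 (by simpa using hx)
      simp [hfix _ this]) (Φ b)
  have hxb := Φ.injective hx
  by_cases h0 : φ (Φ.symm x) = 0
  · rw [hfix _ h0] at hxb
    have h1 : φ b = 1 := hφ1 rfl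
    rw [hxb, h1] at h0
    exact one_ne_zero h0
  · exact moveToCenter_notMem_bou (hφ _) h0 _ (hxb ▸ hb : h (Φ.symm x) ∈ bou n)

theorem IsComfort.eq_of_map_eq {Φ : Spx (n + 1) ≃ₜ Spx (n + 1)} (hΦ : IsComfort Φ)
    {x : Spx (n + 1)} {i j : Fin (n + 1)} (h : (Φ x).1 i = (Φ x).1 j) : x.1 i = x.1 j := by
  have h1 := hΦ.perm (Equiv.swap i j) x
  have h2 : (fun k => (Φ x).1 (Equiv.swap i j k)) = (Φ x).1 := by
    ext k
    rw [Equiv.swap_apply_def]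
    split_ifs with hi hj
    · rw [hi, h]
    · rw [hj, h]
    · rfl
  have h3 := congrArg (fun y => y.1 i) (Φ.injective (Subtype.ext (h1.trans h2)))
  simpa using h3.symm

theorem IsComfort.apply_eq_zero_iff {Φ : Spx (n + 1) ≃ₜ Spx (n + 1)} (hΦ : IsComfort Φ)
    {b : Spx (n + 1)} (hb : b ∈ bou n) (i : Fin (n + 1)) : (Φ b).1 i = 0 ↔ b.1 i = 0 := by
  have hzero (j : Fin (n + 1)) (hj : b.1 j = 0) : (Φ b).1 j = 0 := by
    obtain ⟨k, hk⟩ := map_mem_bou Φ hb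
    exact le_antisymm ((hΦ.mono b j k (hj.trans_le (b.2.1 k))).trans_eq hk) ((Φ b).2.1 j)
  obtain ⟨j, hj⟩ := hb
  exact ⟨fun hi => (hΦ.eq_of_map_eq (hi.trans (hzero j hj).symm)).trans hj, hzero i⟩

end Simplex

theorem comfort_zero_iff_zero (n : ℕ) (hn : 1 ≤ n)
    (Φ : Spx (n+1) ≃ₜ Spx (n+1)) (hΦ : IsComfort Φ)
    (b : Spx (n+1)) (hb : b ∈ bou n) :
    (∀ i : Fin (n+1), (Φ b).1 i = 0 ↔ b.1 i = 0) ∧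
    (∀ (ϑ : Equiv.Perm (Fin (n+1))) (q q' : Fin (n+1)), (q' : ℕ) = (q : ℕ) + 1 →
      (∀ a : Fin (n+1), a ≤ q → b.1 (ϑ a) = 0) → 0 < b.1 (ϑ q') →
      ((∀ a : Fin (n+1), a ≤ q → (Φ b).1 (ϑ a) = 0) ∧ 0 < (Φ b).1 (ϑ q'))) := by
  have key := hΦ.apply_eq_zero_iff hb
  exact ⟨key, fun ϑ q q' _ hz hpos => ⟨fun a ha => (key _).2 (hz a ha),
    ((Φ b).2.1 _).lt_of_ne' fun h => hpos.ne' ((key _).1 h)⟩⟩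

end
end

section
/- Let n ≥ 1, and let α, β satisfy either (0 < α ≤ 1/(n+1) and 0 < β ≤ 1/(n+1)) or α = β = 0. Suppose φ : Layer_{n,α} → Layer_{n,β} is a homeomorphism. Then there exists a homeomorphism Φ : Δ_n → Δ_n whose restriction to Layer_{n,α} equals φ, and Φ can be chosen so that for every γ ∈ [0, 1/(n+1)] there exists δ ∈ [0, 1/(n+1)] such that Φ maps Layer_{n,γ} homeomorphically onto Layer_{n,δ}. Moreover, if φ respects coordinate permutations and keeps the order, then Φ can be chosen to lie in COMFORT(Δ_n). -/
open scoped BigOperators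

noncomputable section

/-- a map `φ` defined on a subset `S ⊆ Δ_n` (with values in a subset `T ⊆ Δ_n`)
respects coordinate permutations and keeps the order. -/
def ComfortOn {n : ℕ} {S T : Set (Spx (n+1))} (φ : ↥S → ↥T) : Prop :=
  (∀ (ϑ : Equiv.Perm (Fin (n+1))) (x : ↥S)
      (h : (⟨fun i => (x : Spx (n+1)).1 (ϑ i), perm_mem ϑ (x : Spx (n+1)).2⟩ : Spx (n+1)) ∈ S),
      ((φ ⟨⟨fun i => (x : Spx (n+1)).1 (ϑ i), perm_mem ϑ (x : Spx (n+1)).2⟩, h⟩ : Spx (n+1)).1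
        = fun i => ((φ x : Spx (n+1)).1 (ϑ i)))) ∧
  (∀ (x : ↥S) (i j : Fin (n+1)),
      (x : Spx (n+1)).1 i ≤ (x : Spx (n+1)).1 j →
      (φ x : Spx (n+1)).1 i ≤ (φ x : Spx (n+1)).1 j)

open Set Filter Topology

section MinCoord

variable {n : ℕ}

lemma minCoord_le (x : Spx (n+1)) (i : Fin (n+1)) : minCoord x ≤ x.1 i :=
  Finset.inf'_le _ (Finset.mem_univ i)

lemma exists_eq_minCoord (x : Spx (n+1)) : ∃ i, x.1 i = minCoord x := by
  obtain ⟨i, -, hi⟩ := Finset.exists_mem_eq_inf' Finset.univ_nonempty x.1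
  exact ⟨i, hi.symm⟩

lemma minCoord_eq {x : Spx (n+1)} {γ : ℝ} (h : ∀ i, γ ≤ x.1 i) (h' : ∃ i, x.1 i = γ) :
    minCoord x = γ := by
  obtain ⟨i, hi⟩ := h'
  exact le_antisymm (hi ▸ minCoord_le x i) (Finset.le_inf' _ _ fun j _ => h j)

lemma minCoord_nonneg (x : Spx (n+1)) : 0 ≤ minCoord x :=
  Finset.le_inf' _ _ fun j _ => x.2.1 j

lemma sum_sub_minCoord (x : Spx (n+1)) :
    ∑ i, (x.1 i - minCoord x) = ((n:ℝ)+1) * (1/((n:ℝ)+1) - minCoord x) := by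
  rw [Finset.sum_sub_distrib, x.2.2]
  simp
  field_simp

lemma minCoord_le_center (x : Spx (n+1)) : minCoord x ≤ 1/((n:ℝ)+1) := by
  have h : 0 ≤ ((n:ℝ)+1) * (1/((n:ℝ)+1) - minCoord x) := by
    rw [← sum_sub_minCoord]
    exact Finset.sum_nonneg fun i _ => sub_nonneg.2 (minCoord_le x i)
  have := nonneg_of_mul_nonneg_right h (by positivity)
  linarith

lemma abs_coord_sub_center_le (x : Spx (n+1)) (i : Fin (n+1)) :
    |x.1 i - 1/((n:ℝ)+1)| ≤ ((n:ℝ)+1) * (1/((n:ℝ)+1) - minCoord x) := by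
  have h1 : x.1 i - minCoord x ≤ ((n:ℝ)+1) * (1/((n:ℝ)+1) - minCoord x) := by
    rw [← sum_sub_minCoord]
    exact Finset.single_le_sum (f := fun i => x.1 i - minCoord x)
      (fun i _ => sub_nonneg.2 (minCoord_le x i)) (Finset.mem_univ i)
  have h2 := minCoord_le_center x
  have h3 := minCoord_le x i
  have h4 : 0 ≤ (n:ℝ) * (1/((n:ℝ)+1) - minCoord x) :=
    mul_nonneg n.cast_nonneg (sub_nonneg.2 h2)
  rw [abs_le]
  constructor <;> linarith

lemma eq_center_of_minCoord_eq {x : Spx (n+1)} (h : minCoord x = 1/((n:ℝ)+1)) :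
    x = center n := by
  ext i
  have := abs_coord_sub_center_le x i
  rw [h, sub_self, mul_zero] at this
  exact sub_eq_zero.1 (abs_nonpos_iff.1 this)

lemma minCoord_center : minCoord (center n) = 1/((n:ℝ)+1) :=
  minCoord_eq (fun _ => le_rfl) ⟨0, rfl⟩

lemma continuous_minCoord : Continuous (minCoord : Spx (n+1) → ℝ) := by
  refine Continuous.finset_inf'_apply Finset.univ_nonempty fun i _ => ?_
  exact (continuous_apply i).comp continuous_subtype_val

lemma minCoord_perm (ϑ : Equiv.Perm (Fin (n+1))) (x : Spx (n+1)) :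
    minCoord (⟨fun i => x.1 (ϑ i), perm_mem ϑ x.2⟩ : Spx (n+1)) = minCoord x := by
  refine minCoord_eq (fun i => minCoord_le x _) ?_
  obtain ⟨i, hi⟩ := exists_eq_minCoord x
  exact ⟨ϑ.symm i, by simpa using hi⟩

end MinCoord

/-- The interval of values of the minimal coordinate on `Spx (n+1)`. -/
abbrev LayerIndex (n : ℕ) : Type := Set.Icc (0:ℝ) (1/((n:ℝ)+1))

/-- The minimal coordinate, with values in the interval of layer indices. -/
def layerIndex {n : ℕ} (x : Spx (n+1)) : LayerIndex n :=
  ⟨minCoord x, minCoord_nonneg x, minCoord_le_center x⟩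

/-- The point with minimal coordinate `γ` on the ray from the barycenter through `x`; it is the
barycenter if `x` is. -/
def radial {n : ℕ} (γ : LayerIndex n) (x : Spx (n+1)) : Spx (n+1) :=
  ⟨fun i => 1/((n:ℝ)+1)
    + (1/((n:ℝ)+1) - γ.1) / (1/((n:ℝ)+1) - minCoord x) * (x.1 i - 1/((n:ℝ)+1)), by
    have hγ := γ.2.1
    have hγ' := γ.2.2
    have hm := minCoord_le_center x
    constructor
    · intro i
      have hi := minCoord_le x i
      rcases hm.eq_or_lt with h | h
      · simp only [h, sub_self, div_zero, zero_mul, add_zero]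
        positivity
      · have h1 : (1/((n:ℝ)+1) - γ.1) / (1/((n:ℝ)+1) - minCoord x)
            * (minCoord x - 1/((n:ℝ)+1)) = -(1/((n:ℝ)+1) - γ.1) := by
          rw [← neg_sub (1/((n:ℝ)+1)) (minCoord x), mul_neg,
            div_mul_cancel₀ _ (sub_pos.2 h).ne']
        have h2 := mul_le_mul_of_nonneg_left (sub_le_sub_right hi (1/((n:ℝ)+1)))
          (div_nonneg (sub_nonneg.2 hγ') (sub_nonneg.2 hm))
        linarith
    · rw [Finset.sum_add_distrib, ← Finset.mul_sum, Finset.sum_sub_distrib, x.2.2]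
      have : ∑ _i : Fin (n+1), 1/((n:ℝ)+1) = 1 := by
        rw [Finset.sum_const, Finset.card_univ, Fintype.card_fin, nsmul_eq_mul]
        push_cast
        field_simp
      rw [this]
      ring⟩

section Radial

variable {n : ℕ}

lemma radial_apply (γ : LayerIndex n) (x : Spx (n+1)) (i : Fin (n+1)) :
    (radial γ x).1 i = 1/((n:ℝ)+1)
      + (1/((n:ℝ)+1) - γ.1) / (1/((n:ℝ)+1) - minCoord x) * (x.1 i - 1/((n:ℝ)+1)) := rfl

lemma radial_center (γ : LayerIndex n) : radial γ (center n) = center n := by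
  refine Subtype.ext (funext fun i => ?_)
  rw [radial_apply, minCoord_center, sub_self, div_zero, zero_mul, add_zero]
  rfl

lemma radial_mono (γ : LayerIndex n) (x : Spx (n+1)) {i j : Fin (n+1)} (h : x.1 i ≤ x.1 j) :
    (radial γ x).1 i ≤ (radial γ x).1 j := by
  rw [radial_apply, radial_apply]
  have := div_nonneg (sub_nonneg.2 γ.2.2) (sub_nonneg.2 (minCoord_le_center x))
  gcongr

lemma minCoord_radial (γ : LayerIndex n) {x : Spx (n+1)} (hx : minCoord x < 1/((n:ℝ)+1)) :
    minCoord (radial γ x) = γ := by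
  obtain ⟨i, hi⟩ := exists_eq_minCoord x
  have h : (radial γ x).1 i = γ := by
    rw [radial_apply, hi, ← neg_sub (1/((n:ℝ)+1)) (minCoord x), mul_neg,
      div_mul_cancel₀ _ (sub_pos.2 hx).ne']
    ring
  refine minCoord_eq (fun j => ?_) ⟨i, h⟩
  rw [← h]
  exact radial_mono γ x (hi ▸ minCoord_le x j)

lemma radial_radial (γ δ : LayerIndex n) (hδ : δ.1 < 1/((n:ℝ)+1)) (x : Spx (n+1)) :
    radial γ (radial δ x) = radial γ x := by
  rcases (minCoord_le_center x).eq_or_lt with h | h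
  · rw [eq_center_of_minCoord_eq h, radial_center, radial_center]
  · refine Subtype.ext (funext fun i => ?_)
    rw [radial_apply, radial_apply, radial_apply, minCoord_radial δ h]
    have h1 := (sub_pos.2 hδ).ne'
    generalize 1/((n:ℝ)+1) - δ.1 = d at *
    rw [add_sub_cancel_left, ← mul_assoc, div_mul_div_cancel₀ h1]

lemma radial_layerIndex (x : Spx (n+1)) : radial (layerIndex x) x = x := by
  rcases (minCoord_le_center x).eq_or_lt with h | h
  · rw [eq_center_of_minCoord_eq h, radial_center]
  · refine Subtype.ext (funext fun i => ?_)
    rw [radial_apply]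
    change _ + (1/((n:ℝ)+1) - minCoord x) / _ * _ = _
    rw [div_self (sub_pos.2 h).ne']
    ring

lemma radial_eq_self {γ : LayerIndex n} {x : Spx (n+1)} (h : minCoord x = γ) :
    radial γ x = x := by
  have : γ = layerIndex x := Subtype.ext h.symm
  rw [this, radial_layerIndex]

lemma radial_perm (γ : LayerIndex n) (ϑ : Equiv.Perm (Fin (n+1))) (x : Spx (n+1)) :
    radial γ ⟨fun i => x.1 (ϑ i), perm_mem ϑ x.2⟩
      = ⟨fun i => (radial γ x).1 (ϑ i), perm_mem ϑ (radial γ x).2⟩ := by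
  refine Subtype.ext (funext fun i => ?_)
  rw [radial_apply, minCoord_perm]
  rfl

lemma continuous_layerIndex : Continuous (layerIndex : Spx (n+1) → LayerIndex n) :=
  continuous_minCoord.subtype_mk _

lemma continuousOn_radial : ContinuousOn (fun p : LayerIndex n × Spx (n+1) => radial p.1 p.2)
    {p | minCoord p.2 < 1/((n:ℝ)+1)} := by
  rw [Topology.IsInducing.subtypeVal.continuousOn_iff]
  refine continuousOn_pi.2 fun i => ?_
  have h1 : Continuous fun p : LayerIndex n × Spx (n+1) => p.1.1 := by fun_prop
  have h2 : Continuous fun p : LayerIndex n × Spx (n+1) => minCoord p.2 :=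
    continuous_minCoord.comp continuous_snd
  have h3 : Continuous fun p : LayerIndex n × Spx (n+1) => p.2.1 i :=
    (continuous_apply i).comp (continuous_subtype_val.comp continuous_snd)
  have h4 : ContinuousOn (fun p : LayerIndex n × Spx (n+1) =>
      (1/((n:ℝ)+1) - p.1.1) / (1/((n:ℝ)+1) - minCoord p.2))
      {p | minCoord p.2 < 1/((n:ℝ)+1)} :=
    (continuous_const.sub h1).continuousOn.div (continuous_const.sub h2).continuousOn
      fun p hp => (sub_pos.2 hp).ne'
  exact continuousOn_const.add (h4.mul (h3.sub continuous_const).continuousOn)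

end Radial

open Classical in
/-- Extend a map between subsets to the ambient type by the identity. -/
def extendById {X : Type*} {S T : Set X} (f : S → T) (x : X) : X :=
  if h : x ∈ S then f ⟨x, h⟩ else x

lemma extendById_of_mem {X : Type*} {S T : Set X} (f : S → T) {x : X} (h : x ∈ S) :
    extendById f x = f ⟨x, h⟩ := dif_pos h

lemma extendById_of_notMem {X : Type*} {S T : Set X} (f : S → T) {x : X} (h : x ∉ S) :
    extendById f x = x := dif_neg h

lemma continuousOn_extendById {X : Type*} [TopologicalSpace X] {S T : Set X} {f : S → T}
    (hf : Continuous f) : ContinuousOn (extendById f) S := by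
  rw [continuousOn_iff_continuous_domRestrict]
  convert continuous_subtype_val.comp hf using 1
  ext x
  exact extendById_of_mem f x.2

/-- The map of the simplex that acts by `f` on directions from the barycenter and by `g` on the
indices of the layers. -/
def conicalMap {n : ℕ} {α β : LayerIndex n} (f : layer n α → layer n β)
    (g : LayerIndex n → LayerIndex n) (x : Spx (n+1)) : Spx (n+1) :=
  radial (g (layerIndex x)) (extendById f (radial α x))

section Conical

variable {n : ℕ} {α β : LayerIndex n}

lemma radial_mem_layer {x : Spx (n+1)} (hx : minCoord x < 1/((n:ℝ)+1)) :
    radial α x ∈ layer n α := minCoord_radial α hx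

lemma conicalMap_of_lt (f : layer n α → layer n β) (g : LayerIndex n → LayerIndex n)
    {x : Spx (n+1)} (hx : minCoord x < 1/((n:ℝ)+1)) :
    conicalMap f g x = radial (g (layerIndex x)) (f ⟨radial α x, radial_mem_layer hx⟩) := by
  rw [conicalMap, extendById_of_mem]

lemma conicalMap_center (hα : α.1 < 1/((n:ℝ)+1)) (f : layer n α → layer n β)
    (g : LayerIndex n → LayerIndex n) : conicalMap f g (center n) = center n := by
  have : center n ∉ layer n α := fun h => by
    have h' : minCoord (center n) = α := h
    rw [minCoord_center] at h'
    exact hα.ne h'.symm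
  rw [conicalMap, radial_center, extendById_of_notMem _ this, radial_center]

lemma layerIndex_conicalMap (hα : α.1 < 1/((n:ℝ)+1)) (hβ : β.1 < 1/((n:ℝ)+1))
    (f : layer n α → layer n β) {g : LayerIndex n → LayerIndex n}
    (hg : g (layerIndex (center n)) = layerIndex (center n)) (x : Spx (n+1)) :
    layerIndex (conicalMap f g x) = g (layerIndex x) := by
  rcases (minCoord_le_center x).eq_or_lt with h | h
  · rw [eq_center_of_minCoord_eq h, conicalMap_center hα, hg]
  · rw [conicalMap_of_lt f g h]
    refine Subtype.ext (minCoord_radial _ ?_)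
    have : minCoord (f ⟨radial α x, radial_mem_layer h⟩ : Spx (n+1)) = β := (f _).2
    rwa [this]

lemma continuous_conicalMap (hα : α.1 < 1/((n:ℝ)+1)) (hβ : β.1 < 1/((n:ℝ)+1))
    {f : layer n α → layer n β} (hf : Continuous f) {g : LayerIndex n → LayerIndex n}
    (hgc : Continuous g) (hg : g (layerIndex (center n)) = layerIndex (center n)) :
    Continuous (conicalMap f g) := by
  rw [continuous_iff_continuousAt]
  intro x
  rcases (minCoord_le_center x).eq_or_lt with h | h
  · rw [eq_center_of_minCoord_eq h, ContinuousAt, conicalMap_center hα, tendsto_subtype_rng,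
      tendsto_pi_nhds]
    intro i
    rw [tendsto_iff_dist_tendsto_zero]
    have hlim : Tendsto (fun y => ((n:ℝ)+1) * (1/((n:ℝ)+1) - (g (layerIndex y)).1))
        (𝓝 (center n)) (𝓝 0) := by
      have hc : Continuous fun y : Spx (n+1) =>
          ((n:ℝ)+1) * (1/((n:ℝ)+1) - (g (layerIndex y)).1) :=
        continuous_const.mul (continuous_const.sub
          (continuous_subtype_val.comp (hgc.comp continuous_layerIndex)))
      have h0 : ((n:ℝ)+1) * (1/((n:ℝ)+1) - (g (layerIndex (center n))).1) = 0 := by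
        rw [hg]
        change _ * (_ - minCoord (center n)) = 0
        rw [minCoord_center, sub_self, mul_zero]
      simpa only [h0] using hc.tendsto (center n)
    refine squeeze_zero (fun _ => dist_nonneg) (fun y => ?_) hlim
    rw [← layerIndex_conicalMap hα hβ f hg y]
    exact abs_coord_sub_center_le (conicalMap f g y) i
  · have hopen : IsOpen {y : Spx (n+1) | minCoord y < 1/((n:ℝ)+1)} :=
      isOpen_lt continuous_minCoord continuous_const
    refine ContinuousOn.continuousAt ?_ (hopen.mem_nhds h)
    have h1 : ContinuousOn (fun y => radial α y) {y : Spx (n+1) | minCoord y < 1/((n:ℝ)+1)} :=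
      continuousOn_radial.comp (f := fun y => (α, y)) (by fun_prop) fun y hy => hy
    have h2 : ContinuousOn (fun y => extendById f (radial α y))
        {y : Spx (n+1) | minCoord y < 1/((n:ℝ)+1)} :=
      (continuousOn_extendById hf).comp h1 fun y hy => radial_mem_layer hy
    refine continuousOn_radial.comp
      (f := fun y => (g (layerIndex y), extendById f (radial α y)))
      ((hgc.comp continuous_layerIndex).continuousOn.prodMk h2) fun y hy => ?_
    change minCoord (extendById f (radial α y)) < _
    rw [extendById_of_mem f (radial_mem_layer hy)]
    have : minCoord (f ⟨radial α y, radial_mem_layer hy⟩ : Spx (n+1)) = β := (f _).2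
    rwa [this]

lemma conicalMap_leftInverse (hα : α.1 < 1/((n:ℝ)+1)) (hβ : β.1 < 1/((n:ℝ)+1))
    {f : layer n α → layer n β} {f' : layer n β → layer n α} (hf : Function.LeftInverse f' f)
    {g g' : LayerIndex n → LayerIndex n} (hgg : Function.LeftInverse g' g)
    (hg : g (layerIndex (center n)) = layerIndex (center n)) :
    Function.LeftInverse (conicalMap f' g') (conicalMap f g) := by
  intro x
  rcases (minCoord_le_center x).eq_or_lt with h | h
  · rw [eq_center_of_minCoord_eq h, conicalMap_center hα, conicalMap_center hβ]
  · have hlt : (g (layerIndex x)).1 < 1/((n:ℝ)+1) := by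
      refine lt_of_le_of_ne (g (layerIndex x)).2.2 fun he => h.ne ?_
      have h1 : g (layerIndex x) = layerIndex (center n) :=
        Subtype.ext (he.trans minCoord_center.symm)
      have h2 := hgg.injective (h1.trans hg.symm)
      exact (congrArg Subtype.val h2).trans minCoord_center
    have hy : minCoord (f ⟨radial α x, radial_mem_layer h⟩ : Spx (n+1)) = β := (f _).2
    have hr : radial β (conicalMap f g x) = f ⟨radial α x, radial_mem_layer h⟩ := by
      rw [conicalMap_of_lt f g h, radial_radial _ _ hlt, radial_eq_self hy]
    rw [conicalMap, layerIndex_conicalMap hα hβ f hg, hgg, hr,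
      extendById_of_mem f' (f ⟨radial α x, radial_mem_layer h⟩).2, Subtype.coe_eta, hf,
      radial_radial _ _ hα, radial_layerIndex]

/-- The conical map of two homeomorphisms, as a homeomorphism. -/
def conicalHomeo (hα : α.1 < 1/((n:ℝ)+1)) (hβ : β.1 < 1/((n:ℝ)+1))
    (φ : layer n α ≃ₜ layer n β) (g : LayerIndex n ≃ₜ LayerIndex n)
    (hg : g (layerIndex (center n)) = layerIndex (center n)) : Spx (n+1) ≃ₜ Spx (n+1) where
  toFun := conicalMap φ g
  invFun := conicalMap φ.symm g.symm
  left_inv := conicalMap_leftInverse hα hβ φ.left_inv g.left_inv hg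
  right_inv := conicalMap_leftInverse hβ hα φ.right_inv g.right_inv (g.symm_apply_eq.2 hg.symm)
  continuous_toFun := continuous_conicalMap hα hβ φ.continuous g.continuous hg
  continuous_invFun := continuous_conicalMap hβ hα φ.symm.continuous g.symm.continuous
    (g.symm_apply_eq.2 hg.symm)

lemma conicalMap_of_mem_layer {f : layer n α → layer n β}
    {g : LayerIndex n → LayerIndex n} (hg : g α = β) (x : layer n α) :
    conicalMap f g x = f x := by
  have hx : minCoord x.1 = α := x.2
  have hy : minCoord (f x).1 = β := (f x).2
  have hi : layerIndex x.1 = α := Subtype.ext hx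
  rw [conicalMap, radial_eq_self hx, hi, hg, extendById_of_mem f x.2, radial_eq_self hy]

lemma extendById_perm {f : layer n α → layer n β} (hf : ComfortOn f)
    (ϑ : Equiv.Perm (Fin (n+1))) (x : Spx (n+1)) :
    extendById f ⟨fun i => x.1 (ϑ i), perm_mem ϑ x.2⟩
      = ⟨fun i => (extendById f x).1 (ϑ i), perm_mem ϑ (extendById f x).2⟩ := by
  have hiff : (⟨fun i => x.1 (ϑ i), perm_mem ϑ x.2⟩ : Spx (n+1)) ∈ layer n α ↔ x ∈ layer n α := by
    simp only [layer, mem_ofPred_eq, minCoord_perm]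
  refine Subtype.ext ?_
  by_cases h : x ∈ layer n α
  · rw [extendById_of_mem f (hiff.2 h), hf.1 ϑ ⟨x, h⟩ (hiff.2 h)]
    simp only [extendById_of_mem f h]
  · rw [extendById_of_notMem f (mt hiff.1 h)]
    simp only [extendById_of_notMem f h]

lemma isComfort_conicalHomeo (hα : α.1 < 1/((n:ℝ)+1)) (hβ : β.1 < 1/((n:ℝ)+1))
    (φ : layer n α ≃ₜ layer n β) (g : LayerIndex n ≃ₜ LayerIndex n)
    (hg : g (layerIndex (center n)) = layerIndex (center n)) (hφ : ComfortOn φ) :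
    IsComfort (conicalHomeo hα hβ φ g hg) where
  perm ϑ x := by
    have hi : layerIndex (⟨fun i => x.1 (ϑ i), perm_mem ϑ x.2⟩ : Spx (n+1)) = layerIndex x :=
      Subtype.ext (minCoord_perm ϑ x)
    change (conicalMap φ g _).1 = fun i => (conicalMap φ g x).1 (ϑ i)
    rw [conicalMap, hi, radial_perm, extendById_perm hφ, radial_perm]
    rfl
  mono x i j h := by
    refine radial_mono _ _ ?_
    have h' := radial_mono α x h
    by_cases hm : radial α x ∈ layer n α
    · rw [extendById_of_mem _ hm]
      exact hφ.2 ⟨_, hm⟩ i j h'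
    · rwa [extendById_of_notMem _ hm]

lemma image_conicalHomeo_layer (hα : α.1 < 1/((n:ℝ)+1)) (hβ : β.1 < 1/((n:ℝ)+1))
    (φ : layer n α ≃ₜ layer n β) (g : LayerIndex n ≃ₜ LayerIndex n)
    (hg : g (layerIndex (center n)) = layerIndex (center n)) (γ : LayerIndex n) :
    conicalHomeo hα hβ φ g hg '' layer n γ = layer n (g γ) := by
  have key (γ : LayerIndex n) (x : Spx (n+1)) : x ∈ layer n γ ↔ layerIndex x = γ :=
    (Subtype.ext_iff (a1 := layerIndex x)).symm
  have hidx (x : Spx (n+1)) : layerIndex (conicalHomeo hα hβ φ g hg x) = g (layerIndex x) :=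
    layerIndex_conicalMap hα hβ φ hg x
  ext y
  obtain ⟨x, rfl⟩ := (conicalHomeo hα hβ φ g hg).surjective y
  rw [(conicalHomeo hα hβ φ g hg).injective.mem_set_image, key, key, hidx,
    g.injective.eq_iff]

end Conical

lemma mobius_denom_pos {c k t : ℝ} (hc : 0 < c) (hk : 0 < k) (ht : t ∈ Icc 0 c) :
    0 < c - t + k * t := by
  rcases ht.2.eq_or_lt with h | h
  · rw [h]
    have := mul_pos hk hc
    linarith
  · have := mul_nonneg hk.le ht.1
    linarith

lemma mobius_mem {c k t : ℝ} (hc : 0 < c) (hk : 0 < k) (ht : t ∈ Icc 0 c) :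
    c * (k * t) / (c - t + k * t) ∈ Icc 0 c := by
  have hd := mobius_denom_pos hc hk ht
  have hkt := mul_nonneg hk.le ht.1
  refine ⟨by positivity, ?_⟩
  rw [div_le_iff₀ hd]
  exact mul_le_mul_of_nonneg_left (by linarith [ht.2]) hc.le

/-- The Möbius transformation of `[0, c]` fixing both ends with parameter `k`. -/
def mobius {c k : ℝ} (hc : 0 < c) (hk : 0 < k) (t : Icc 0 c) : Icc 0 c :=
  ⟨c * (k * t) / (c - t + k * t), mobius_mem hc hk t.2⟩

lemma continuous_mobius {c k : ℝ} (hc : 0 < c) (hk : 0 < k) : Continuous (mobius hc hk) := by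
  refine Continuous.subtype_mk (Continuous.div (by fun_prop) (by fun_prop) fun t => ?_) _
  exact (mobius_denom_pos hc hk t.2).ne'

lemma mobius_leftInverse {c k l : ℝ} (hc : 0 < c) (hk : 0 < k) (hl : 0 < l) (hkl : l * k = 1) :
    Function.LeftInverse (mobius hc hl) (mobius hc hk) := by
  intro t
  refine Subtype.ext ?_
  have hd := (mobius_denom_pos hc hk t.2).ne'
  have hd' := (mobius_denom_pos hc hl (mobius hc hk t).2).ne'
  change c * (l * (mobius hc hk t).1) / (c - (mobius hc hk t).1 + l * (mobius hc hk t).1) = t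
  rw [div_eq_iff hd']
  change c * (l * (c * (k * t) / (c - t + k * t)))
    = t * (c - c * (k * t) / (c - t + k * t) + l * (c * (k * t) / (c - t + k * t)))
  generalize (t : ℝ) = t at *
  field_simp
  linear_combination t * (c - t) * hkl

/-- Homeomorphisms of `[0, c]` fixing the right end act transitively on the interior. -/
lemma exists_homeo_Icc {c : ℝ} (hc : 0 < c) (a b : Icc 0 c)
    (h : (0 < a.1 ∧ a.1 < c ∧ 0 < b.1 ∧ b.1 < c) ∨ a = b) :
    ∃ g : Icc 0 c ≃ₜ Icc 0 c, g a = b ∧ ∀ t, t.1 = c → g t = t := by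
  rcases h with ⟨ha, ha', hb, hb'⟩ | rfl
  · have ha'' := sub_pos.2 ha'
    have hb'' := sub_pos.2 hb'
    have hk : 0 < b.1 * (c - a) / (a * (c - b)) := by positivity
    have hl : 0 < a.1 * (c - b) / (b * (c - a)) := by positivity
    have hkl : a.1 * (c - b) / (b * (c - a)) * (b.1 * (c - a) / (a * (c - b))) = 1 := by
      field_simp
    refine ⟨⟨⟨mobius hc hk, mobius hc hl, mobius_leftInverse hc hk hl hkl,
      mobius_leftInverse hc hl hk (by rw [mul_comm, hkl])⟩, continuous_mobius hc hk,
      continuous_mobius hc hl⟩, Subtype.ext ?_, fun t ht => Subtype.ext ?_⟩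
    · change c * (b.1 * (c - a) / (a * (c - b)) * a)
        / (c - a + b.1 * (c - a) / (a * (c - b)) * a) = b
      rw [div_eq_iff (mobius_denom_pos hc hk a.2).ne']
      field_simp
      ring
    · change c * (b.1 * (c - a) / (a * (c - b)) * t)
        / (c - t + b.1 * (c - a) / (a * (c - b)) * t) = t
      rw [ht, sub_self, zero_add, mul_div_assoc, div_self (mul_pos hk hc).ne', mul_one]
  · exact ⟨Homeomorph.refl _, rfl, fun _ _ => rfl⟩

lemma subsingleton_layer_center (n : ℕ) : Subsingleton (layer n (1/((n:ℝ)+1))) :=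
  ⟨fun x y => Subtype.ext
    ((eq_center_of_minCoord_eq x.2).trans (eq_center_of_minCoord_eq y.2).symm)⟩

lemma not_subsingleton_layer {n : ℕ} (hn : 1 ≤ n) (γ : LayerIndex n) (hγ : γ.1 < 1/((n:ℝ)+1)) :
    ¬ Subsingleton (layer n γ) := by
  intro hs
  have hne : (0 : Fin (n+1)) ≠ Fin.last n := by
    simp [Fin.ext_iff]
    omega
  let e (i : Fin (n+1)) : Spx (n+1) := ⟨Pi.single i 1, single_mem_stdSimplex ℝ i⟩
  have hmin (i : Fin (n+1)) : minCoord (e i) = 0 := by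
    refine minCoord_eq (e i).2.1 ?_
    by_cases hi : i = 0
    · exact ⟨Fin.last n, Pi.single_eq_of_ne (hi ▸ hne.symm) _⟩
    · exact ⟨0, Pi.single_eq_of_ne (Ne.symm hi) _⟩
  have hlt (i : Fin (n+1)) : minCoord (e i) < 1/((n:ℝ)+1) := by
    rw [hmin]
    positivity
  have heq : radial γ (e 0) = radial γ (e (Fin.last n)) := congrArg Subtype.val
    (hs.elim ⟨_, minCoord_radial γ (hlt 0)⟩ ⟨_, minCoord_radial γ (hlt (Fin.last n))⟩)
  have hidx : layerIndex (e 0) = layerIndex (e (Fin.last n)) :=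
    Subtype.ext ((hmin _).trans (hmin _).symm)
  have he : e 0 = e (Fin.last n) := by
    rw [← radial_layerIndex (e 0), ← radial_radial _ γ hγ, heq, radial_radial _ γ hγ, hidx,
      radial_layerIndex]
  have h1 : (e 0).1 0 = (e (Fin.last n)).1 0 := by rw [he]
  simp [e, Pi.single_eq_of_ne hne] at h1

theorem layer_homeo_extends (n : ℕ) (hn : 1 ≤ n) (α β : ℝ)
    (hαβ : (0 < α ∧ α ≤ 1/((n:ℝ)+1) ∧ 0 < β ∧ β ≤ 1/((n:ℝ)+1)) ∨ (α = 0 ∧ β = 0))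
    (φ : ↥(layer n α) ≃ₜ ↥(layer n β)) :
    ∃ Φ : Spx (n+1) ≃ₜ Spx (n+1),
      (∀ x : ↥(layer n α), Φ (x : Spx (n+1)) = (φ x : Spx (n+1))) ∧
      (∀ γ : ℝ, 0 ≤ γ → γ ≤ 1/((n:ℝ)+1) →
        ∃ δ : ℝ, 0 ≤ δ ∧ δ ≤ 1/((n:ℝ)+1) ∧ ⇑Φ '' layer n γ = layer n δ) ∧
      (ComfortOn ⇑φ → IsComfort Φ) := by
  have hc : (0:ℝ) < 1/((n:ℝ)+1) := by positivity
  have hαI : α ∈ Icc 0 (1/((n:ℝ)+1)) := by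
    rcases hαβ with h | h
    · exact ⟨h.1.le, h.2.1⟩
    · exact ⟨h.1.ge, h.1.trans_le hc.le⟩
  have hβI : β ∈ Icc 0 (1/((n:ℝ)+1)) := by
    rcases hαβ with h | h
    · exact ⟨h.2.2.1.le, h.2.2.2⟩
    · exact ⟨h.2.ge, h.2.trans_le hc.le⟩
  have hiff : α = 1/((n:ℝ)+1) ↔ β = 1/((n:ℝ)+1) := by
    constructor
    · rintro rfl
      by_contra h
      have := subsingleton_layer_center n
      exact not_subsingleton_layer hn ⟨β, hβI⟩ (lt_of_le_of_ne hβI.2 h)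
        φ.symm.injective.subsingleton
    · rintro rfl
      by_contra h
      have := subsingleton_layer_center n
      exact not_subsingleton_layer hn ⟨α, hαI⟩ (lt_of_le_of_ne hαI.2 h)
        φ.injective.subsingleton
  by_cases hα : α = 1/((n:ℝ)+1)
  · have hβ := hiff.1 hα
    subst hα
    subst hβ
    have := subsingleton_layer_center n
    exact ⟨Homeomorph.refl _, fun x => congrArg Subtype.val (Subsingleton.elim x (φ x)),
      fun γ h0 h1 => ⟨γ, h0, h1, image_id _⟩, fun _ => ⟨fun _ _ => rfl, fun _ _ _ h => h⟩⟩
  · have hα' : α < 1/((n:ℝ)+1) := lt_of_le_of_ne hαI.2 hα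
    have hβ' : β < 1/((n:ℝ)+1) := lt_of_le_of_ne hβI.2 (mt hiff.2 hα)
    obtain ⟨g, hg, hgc⟩ := exists_homeo_Icc hc ⟨α, hαI⟩ ⟨β, hβI⟩ (by
      rcases hαβ with h | h
      · exact Or.inl ⟨h.1, hα', h.2.2.1, hβ'⟩
      · exact Or.inr (Subtype.ext (h.1.trans h.2.symm)))
    have hgc' := hgc (layerIndex (center n)) minCoord_center
    refine ⟨conicalHomeo (α := ⟨α, hαI⟩) (β := ⟨β, hβI⟩) hα' hβ' φ g hgc', fun x => ?_,
      fun γ h0 h1 => ?_, isComfort_conicalHomeo (α := ⟨α, hαI⟩) (β := ⟨β, hβI⟩) hα' hβ' φ g hgc'⟩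
    · exact conicalMap_of_mem_layer (α := ⟨α, hαI⟩) (β := ⟨β, hβI⟩) hg x
    · exact ⟨g ⟨γ, h0, h1⟩, (g _).2.1, (g _).2.2,
        image_conicalHomeo_layer (α := ⟨α, hαI⟩) (β := ⟨β, hβI⟩) hα' hβ' φ g hgc' ⟨γ, h0, h1⟩⟩

end
end

section
/- Let n ≥ 1 and let α, β satisfy 0 ≤ α < 1/(n+1) and 0 ≤ β < 1/(n+1). Let φ : BOU_n → BOU_n be a homeomorphism which respects coordinate permutations and keeps the order, and which restricts to a homeomorphism of BOU_n ∩ ♣_{n,α} onto BOU_n ∩ ♣_{n,β}. Then there exists Φ ∈ COMFORT(Δ_n) whose restriction to BOU_n equals φ and which restricts to a homeomorphism of ♣_{n,α} onto ♣_{n,β}. -/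
open scoped BigOperators

noncomputable section

/-- The point at ratio `t` on the ray from `w` through `x`. -/
def dilate {n : ℕ} (w : Fin (n+1) → ℝ) (t : ℝ) (x : Fin (n+1) → ℝ) : Fin (n+1) → ℝ :=
  fun i => w i + t * (x i - w i)

/-- The closed Weyl chamber of the simplex: points with weakly increasing coordinates. -/
def chamber (n : ℕ) : Set (Fin (n+1) → ℝ) := {x | x ∈ stdSimplex ℝ (Fin (n+1)) ∧ Monotone x}

/-- The points of the chamber which lie in the boundary or have `m` coordinates at most `α`. -/
def region (n m : ℕ) (α : ℝ) : Set (Fin (n+1) → ℝ) :=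
  {x | x ∈ chamber n ∧ (x 0 = 0 ∨ ∀ i : Fin (n+1), i.val < m → x i ≤ α)}

/-- The closed cell of the chamber cut by the `α`-cross on which the `k` smallest coordinates are
at most `α` and the others at least `α`. -/
def cell {n : ℕ} (k : Fin (n+1)) (α : ℝ) : Set (Fin (n+1) → ℝ) :=
  {x | x ∈ chamber n ∧ (∀ i, i < k → x i ≤ α) ∧ α ≤ x k}

/-- The common value of the large coordinates of `apex k α`. -/
def apexTop {n : ℕ} (k : Fin (n+1)) (α : ℝ) : ℝ := (1 - k.val * α) / (n + 1 - k.val)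

/-- The vertex of `cell k α` with `k` coordinates `α` and all other coordinates equal. -/
def apex {n : ℕ} (k : Fin (n+1)) (α : ℝ) : Fin (n+1) → ℝ :=
  fun i => if i < k then α else apexTop k α

/-- The gauge of `cell k α` as a cone with vertex `apex k α`. -/
def coneGauge {n : ℕ} (k : Fin (n+1)) (α : ℝ) (x : Fin (n+1) → ℝ) : ℝ :=
  max (1 - x 0 / apex k α 0) ((apexTop k α - x k) / (apexTop k α - α))

/-- Parameters for which `cell k α` is a nondegenerate cone over its faces opposite to the apex. -/
structure Admissible {n : ℕ} (k : Fin (n+1)) (α : ℝ) : Prop where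
  nonneg : 0 ≤ α
  lt : α * (n + 1) < 1
  pos : k = 0 ∨ 0 < α

section Cone

variable {n : ℕ} {k : Fin (n+1)} {α β : ℝ} {x : Fin (n+1) → ℝ}

lemma codim_pos (k : Fin (n+1)) : (0:ℝ) < n + 1 - k.val := by
  have : (k.val : ℝ) < n + 1 := by exact_mod_cast k.isLt
  linarith

lemma apexTop_mul (k : Fin (n+1)) (α : ℝ) :
    apexTop k α * (n + 1 - k.val) = 1 - k.val * α :=
  div_mul_cancel₀ _ (codim_pos k).ne'

lemma Admissible.lt_apexTop (h : Admissible k α) : α < apexTop k α := by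
  rw [apexTop, lt_div_iff₀ (codim_pos k)]
  linarith [h.lt]

lemma Admissible.apex_zero_pos (h : Admissible k α) : 0 < apex k α 0 := by
  unfold apex
  split_ifs with hk
  · rcases h.pos with h0 | h0
    · simp [h0] at hk
    · exact h0
  · exact h.nonneg.trans_lt h.lt_apexTop

lemma apex_of_lt {i : Fin (n+1)} (hi : i < k) : apex k α i = α := if_pos hi

lemma apex_of_le {i : Fin (n+1)} (hi : k ≤ i) : apex k α i = apexTop k α := if_neg hi.not_gt

lemma sum_apex : ∑ i, apex k α i = 1 := by
  have h1 : (Finset.univ.filter fun i : Fin (n+1) => i < k).card = k.val := by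
    rw [← Fin.card_Iio k]; congr 1; ext; simp
  have h2 : (Finset.univ.filter fun i : Fin (n+1) => ¬ i < k).card = n + 1 - k.val := by
    rw [← Fin.card_Ici k]; congr 1; ext; simp
  simp only [apex, Finset.sum_ite, Finset.sum_const, h1, h2, nsmul_eq_mul]
  rw [Nat.cast_sub k.isLt.le]
  push_cast
  linarith [apexTop_mul k α]

lemma Admissible.apex_mem (h : Admissible k α) : apex k α ∈ cell k α := by
  have hlt := h.lt_apexTop
  refine ⟨⟨⟨fun i => ?_, sum_apex⟩, fun i j hij => ?_⟩, fun i hi => (apex_of_lt hi).le, ?_⟩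
  · unfold apex
    split_ifs <;> linarith [h.nonneg]
  · unfold apex
    split_ifs with h1 h2 h2
    · exact le_rfl
    · exact hlt.le
    · exact absurd (hij.trans_lt h2) h1
    · exact le_rfl
  · rw [apex_of_le le_rfl]; exact hlt.le

lemma sum_dilate {w y : Fin (n+1) → ℝ} (hw : ∑ i, w i = 1) (hy : ∑ i, y i = 1) (t : ℝ) :
    ∑ i, dilate w t y i = 1 := by
  simp only [dilate, Finset.sum_add_distrib, ← Finset.mul_sum, Finset.sum_sub_distrib, hw, hy]
  ring

lemma cell_ge (hx : x ∈ cell k α) {i : Fin (n+1)} (hi : k ≤ i) : α ≤ x i :=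
  hx.2.2.trans (hx.1.2 hi)

lemma dilate_mem_cell {w : Fin (n+1) → ℝ} (hw : w ∈ cell k α) (hx : x ∈ cell k α) {t : ℝ}
    (ht0 : 0 ≤ t) (ht1 : t ≤ 1) : dilate w t x ∈ cell k α := by
  have e : ∀ i, dilate w t x i = (1 - t) * w i + t * x i := fun i => by
    simp only [dilate]; ring
  have ht : 0 ≤ 1 - t := by linarith
  refine ⟨⟨⟨fun i => ?_, sum_dilate hw.1.1.2 hx.1.1.2 t⟩, fun i j hij => ?_⟩, fun i hi => ?_, ?_⟩
  · rw [e]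
    exact add_nonneg (mul_nonneg ht (hw.1.1.1 i)) (mul_nonneg ht0 (hx.1.1.1 i))
  · rw [e, e]
    gcongr
    exacts [hw.1.2 hij, hx.1.2 hij]
  · rw [e]
    nlinarith [mul_le_mul_of_nonneg_left (hw.2.1 i hi) ht,
      mul_le_mul_of_nonneg_left (hx.2.1 i hi) ht0]
  · rw [e]
    nlinarith [mul_le_mul_of_nonneg_left hw.2.2 ht, mul_le_mul_of_nonneg_left hx.2.2 ht0]

lemma Admissible.coneGauge_dilate (h : Admissible k α) (x : Fin (n+1) → ℝ) {t : ℝ} (ht : 0 ≤ t) :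
    coneGauge k α (dilate (apex k α) t x) = t * coneGauge k α x := by
  have h0 := h.apex_zero_pos.ne'
  have h1 : apexTop k α - α ≠ 0 := (sub_pos.2 h.lt_apexTop).ne'
  rw [coneGauge, coneGauge, mul_max_of_nonneg _ _ ht]
  congr 1
  · simp only [dilate]; field_simp; ring
  · simp only [dilate, apex_of_le le_rfl]; field_simp; ring

lemma Admissible.coneGauge_apex (h : Admissible k α) : coneGauge k α (apex k α) = 0 := by
  have h0 := h.apex_zero_pos.ne'
  simp [coneGauge, h0, apex_of_le]

lemma Admissible.coneGauge_le_one (h : Admissible k α) (hx : x ∈ cell k α) : coneGauge k α x ≤ 1 := by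
  have h1 : 0 < apexTop k α - α := sub_pos.2 h.lt_apexTop
  refine max_le ?_ ?_
  · linarith [div_nonneg (hx.1.1.1 0) h.apex_zero_pos.le]
  · rw [div_le_one h1]; linarith [hx.2.2]

lemma Admissible.coneGauge_eq_one (h : Admissible k α) (hx : x ∈ cell k α)
    (hb : x 0 = 0 ∨ x k = α) : coneGauge k α x = 1 := by
  have h1 : 0 < apexTop k α - α := sub_pos.2 h.lt_apexTop
  refine le_antisymm (h.coneGauge_le_one hx) ?_
  rcases hb with hb | hb
  · exact le_max_of_le_left (by simp [hb])
  · exact le_max_of_le_right (by rw [hb, div_self h1.ne'])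

lemma Admissible.eq_apex (h : Admissible k α) (hx : x ∈ cell k α) (hg : coneGauge k α x ≤ 0) :
    x = apex k α := by
  have h1 : 0 < apexTop k α - α := sub_pos.2 h.lt_apexTop
  have ha := (le_max_left _ _).trans hg
  have hb := (le_max_right _ _).trans hg
  rw [sub_nonpos, one_le_div h.apex_zero_pos] at ha
  rw [div_le_iff₀ h1] at hb
  have hle : ∀ i ∈ Finset.univ, apex k α i ≤ x i := fun i _ => by
    rcases lt_or_ge i k with hi | hi
    · have h0 : (0 : Fin (n+1)) < k := (Fin.zero_le i).trans_lt hi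
      rw [apex_of_lt h0] at ha
      rw [apex_of_lt hi]
      exact ha.trans (hx.1.2 (Fin.zero_le i))
    · rw [apex_of_le hi]
      linarith [hx.1.2 hi]
  have := (Finset.sum_eq_sum_iff_of_le hle).1 (sum_apex.trans hx.1.1.2.symm)
  exact funext fun i => (this i (Finset.mem_univ i)).symm

lemma Admissible.coneGauge_nonneg (h : Admissible k α) (hx : x ∈ cell k α) : 0 ≤ coneGauge k α x := by
  by_contra! hg
  rw [h.eq_apex hx hg.le, h.coneGauge_apex] at hg
  exact hg.false

/-- The projection of a point of the cone from its apex to the base. -/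
def project (k : Fin (n+1)) (α : ℝ) (x : Fin (n+1) → ℝ) : Fin (n+1) → ℝ :=
  dilate (apex k α) (coneGauge k α x)⁻¹ x

lemma dilate_dilate_inv (w x : Fin (n+1) → ℝ) {t : ℝ} (ht : t ≠ 0) :
    dilate w t (dilate w t⁻¹ x) = x := by
  funext i; simp only [dilate]; field_simp; ring

lemma dilate_inv_dilate (w x : Fin (n+1) → ℝ) {t : ℝ} (ht : t ≠ 0) :
    dilate w t⁻¹ (dilate w t x) = x := by
  funext i; simp only [dilate]; field_simp; ring

lemma dilate_one (w x : Fin (n+1) → ℝ) : dilate w 1 x = x := by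
  funext i; simp [dilate]

lemma dilate_zero (w x : Fin (n+1) → ℝ) : dilate w 0 x = w := by
  funext i; simp [dilate]

lemma Admissible.project_mem (h : Admissible k α) (hx : x ∈ cell k α)
    (hg : 0 < coneGauge k α x) :
    project k α x ∈ cell k α ∧ (project k α x 0 = 0 ∨ project k α x k = α) := by
  have h0 := h.apex_zero_pos
  have h1 : 0 < apexTop k α - α := sub_pos.2 h.lt_apexTop
  set t := coneGauge k α x with ht
  have hi : 0 < t⁻¹ := inv_pos.2 hg
  have hti : t⁻¹ * t = 1 := inv_mul_cancel₀ hg.ne'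
  have e : ∀ i, project k α x i = apex k α i + t⁻¹ * (x i - apex k α i) := fun i => rfl
  have ha : 1 - x 0 / apex k α 0 ≤ t := le_max_left _ _
  have hb : (apexTop k α - x k) / (apexTop k α - α) ≤ t := le_max_right _ _
  have hab : t = 1 - x 0 / apex k α 0 ∨ t = (apexTop k α - x k) / (apexTop k α - α) :=
    max_choice _ _
  have y0 : 0 ≤ project k α x 0 := by
    have := mul_le_mul_of_nonneg_left ha hi.le
    have h2 := mul_le_mul_of_nonneg_right this h0.le
    rw [hti, mul_assoc, sub_mul, div_mul_cancel₀ _ h0.ne'] at h2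
    rw [e]; linarith
  have yk : α ≤ project k α x k := by
    rw [div_le_iff₀ h1] at hb
    have h2 := mul_le_mul_of_nonneg_left hb hi.le
    rw [← mul_assoc, hti] at h2
    rw [e, apex_of_le le_rfl]; linarith
  have low : ∀ i, i < k → project k α x i ≤ α := fun i hik => by
    rw [e, apex_of_lt hik]
    nlinarith [hx.2.1 i hik]
  have hlow : ∀ i j, i ≤ j → j < k → project k α x i ≤ project k α x j := fun i j hij hj => by
    rw [e, e, apex_of_lt hj, apex_of_lt (hij.trans_lt hj)]
    nlinarith [hx.1.2 hij]
  have hhigh : ∀ i j, i ≤ j → k ≤ i → project k α x i ≤ project k α x j := fun i j hij hj => by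
    rw [e, e, apex_of_le hj, apex_of_le (hj.trans hij)]
    nlinarith [hx.1.2 hij]
  have hmono : Monotone (project k α x) := fun i j hij => by
    rcases lt_or_ge j k with hj | hj
    · exact hlow i j hij hj
    · rcases lt_or_ge i k with hik | hik
      · exact (low i hik).trans (yk.trans (hhigh k j hj le_rfl))
      · exact hhigh i j hij hik
  refine ⟨⟨⟨⟨fun i => y0.trans (hmono (Fin.zero_le i)), sum_dilate sum_apex hx.1.1.2 _⟩, hmono⟩,
    low, yk⟩, ?_⟩
  refine hab.imp (fun hab => ?_) fun hab => ?_
  · have h2 : x 0 = apex k α 0 * (1 - t) := by rw [hab]; field_simp; ring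
    rw [e, h2]
    linear_combination (-apex k α 0) * hti
  · have h2 : x k = apexTop k α - t * (apexTop k α - α) := by rw [hab]; field_simp; ring
    rw [e, apex_of_le le_rfl, h2]
    linear_combination (-(apexTop k α - α)) * hti

lemma Admissible.dilate_project (h : Admissible k α) (hx : x ∈ cell k α) :
    dilate (apex k α) (coneGauge k α x) (project k α x) = x := by
  rcases (h.coneGauge_nonneg hx).eq_or_lt with hg | hg
  · rw [← hg, dilate_zero, h.eq_apex hx hg.symm.le]
  · exact dilate_dilate_inv _ _ hg.ne'

lemma continuous_coneGauge (k : Fin (n+1)) (α : ℝ) : Continuous (coneGauge k α) := by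
  unfold coneGauge; fun_prop

lemma isClosed_chamber (n : ℕ) : IsClosed (chamber n) :=
  (isClosed_stdSimplex ℝ (Fin (n+1))).inter isClosed_monotone

lemma isClosed_forall_imp_le (p : Fin (n+1) → Prop) (α : ℝ) :
    IsClosed {x : Fin (n+1) → ℝ | ∀ i, p i → x i ≤ α} := by
  simp only [Set.ofPred_forall]
  exact isClosed_iInter fun i => isClosed_iInter fun _ =>
    isClosed_le (continuous_apply i) continuous_const

lemma isClosed_cell (k : Fin (n+1)) (α : ℝ) : IsClosed (cell k α) :=
  (isClosed_chamber n).inter ((isClosed_forall_imp_le (· < k) α).inter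
    (isClosed_le continuous_const (continuous_apply k)))

lemma isClosed_region (n m : ℕ) (α : ℝ) : IsClosed (region n m α) :=
  (isClosed_chamber n).inter ((isClosed_eq (continuous_apply 0) continuous_const).union
    (isClosed_forall_imp_le (·.val < m) α))

lemma region_succ_of_base (hx : x ∈ cell k α) (hb : x 0 = 0 ∨ x k = α) :
    x ∈ region n (k.val + 1) α := by
  refine ⟨hx.1, hb.imp_right fun hb i hi => ?_⟩
  exact (hx.1.2 (Fin.le_def.2 (Nat.lt_succ_iff.1 hi))).trans hb.le

lemma base_of_region_succ (hx : x ∈ cell k α) (hr : x ∈ region n (k.val + 1) α) :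
    x 0 = 0 ∨ x k = α :=
  hr.2.imp_right fun h => le_antisymm (h k (Nat.lt_succ_self _)) hx.2.2

lemma region_eq (k : Fin (n+1)) (α : ℝ) :
    region n k.val α = region n (k.val + 1) α ∪ cell k α := by
  ext x
  constructor
  · rintro ⟨hx, h0 | h0⟩
    · exact Or.inl ⟨hx, Or.inl h0⟩
    · rcases le_total (x k) α with hk | hk
      · exact Or.inl ⟨hx, Or.inr fun i hi =>
          (hx.2 (Fin.le_def.2 (Nat.lt_succ_iff.1 hi))).trans hk⟩
      · exact Or.inr ⟨hx, fun i hi => h0 i hi, hk⟩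
  · rintro (⟨hx, h0⟩ | ⟨hx, h0, -⟩)
    · exact ⟨hx, h0.imp_right fun h i hi => h i (hi.trans (Nat.lt_succ_self _))⟩
    · exact ⟨hx, Or.inr fun i hi => h0 i hi⟩

/-- `F` is a continuous map of `region n m α` into the chamber which respects all the walls: those
of the chamber, the boundary of the simplex, and the crosses at levels `α` and `β`. -/
structure RespectsWalls (n m : ℕ) (α β : ℝ) (F : (Fin (n+1) → ℝ) → (Fin (n+1) → ℝ)) : Prop where
  mem : ∀ x ∈ region n m α, F x ∈ chamber n
  eq : ∀ x ∈ region n m α, ∀ i j, x i = x j → F x i = F x j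
  le : ∀ x ∈ region n m α, ∀ i, x i ≤ α → F x i ≤ β
  ge : ∀ x ∈ region n m α, ∀ i, α ≤ x i → β ≤ F x i
  zero : ∀ x ∈ region n m α, x 0 = 0 → F x 0 = 0
  cont : ContinuousOn F (region n m α)

open Classical in
/-- The extension of `F` to `cell k α` by coning off. -/
def coneExtend (k : Fin (n+1)) (α β : ℝ) (F : (Fin (n+1) → ℝ) → (Fin (n+1) → ℝ))
    (x : Fin (n+1) → ℝ) : Fin (n+1) → ℝ :=
  if x ∈ cell k α then dilate (apex k β) (coneGauge k α x) (F (project k α x)) else F x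

variable {F G : (Fin (n+1) → ℝ) → (Fin (n+1) → ℝ)}

lemma coneExtend_of_mem (hx : x ∈ cell k α) :
    coneExtend k α β F x = dilate (apex k β) (coneGauge k α x) (F (project k α x)) := if_pos hx

lemma Admissible.coneExtend_eq (h : Admissible k α) (hx : x ∈ region n (k.val + 1) α) :
    coneExtend k α β F x = F x := by
  by_cases hc : x ∈ cell k α
  · rw [coneExtend_of_mem hc, project, h.coneGauge_eq_one hc (base_of_region_succ hc hx), inv_one,
      dilate_one, dilate_one]
  · exact if_neg hc

lemma RespectsWalls.base_mem {m : ℕ} (hF : RespectsWalls n m α β F) (hr : x ∈ region n m α)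
    (hx : x ∈ cell k α) (hb : x 0 = 0 ∨ x k = α) :
    F x ∈ cell k β ∧ (F x 0 = 0 ∨ F x k = β) :=
  ⟨⟨hF.mem x hr, fun i hi => hF.le x hr i (hx.2.1 i hi), hF.ge x hr k hx.2.2⟩,
    hb.imp (hF.zero x hr) fun hb => le_antisymm (hF.le x hr k hb.le) (hF.ge x hr k hb.ge)⟩

lemma RespectsWalls.image_project (hF : RespectsWalls n (k.val + 1) α β F) (h : Admissible k α)
    (hx : x ∈ cell k α) (hg : 0 < coneGauge k α x) :
    F (project k α x) ∈ cell k β ∧ (F (project k α x) 0 = 0 ∨ F (project k α x) k = β) :=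
  have hp := h.project_mem hx hg
  hF.base_mem (region_succ_of_base hp.1 hp.2) hp.1 hp.2

lemma RespectsWalls.coneExtend_mem_cell (hF : RespectsWalls n (k.val + 1) α β F)
    (h : Admissible k α) (h' : Admissible k β) (hx : x ∈ cell k α) :
    coneExtend k α β F x ∈ cell k β := by
  rw [coneExtend_of_mem hx]
  rcases (h.coneGauge_nonneg hx).eq_or_lt with hg | hg
  · rw [← hg, dilate_zero]
    exact h'.apex_mem
  · exact dilate_mem_cell h'.apex_mem (hF.image_project h hx hg).1 hg.le (h.coneGauge_le_one hx)

lemma abs_sub_le_one_of_mem_chamber {x y : Fin (n+1) → ℝ} (hx : x ∈ chamber n)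
    (hy : y ∈ chamber n) (i : Fin (n+1)) : |x i - y i| ≤ 1 := by
  have h1 := mem_Icc_of_mem_stdSimplex hx.1 i
  have h2 := mem_Icc_of_mem_stdSimplex hy.1 i
  rw [abs_le]
  constructor <;> linarith [h1.1, h1.2, h2.1, h2.2]

lemma RespectsWalls.continuousOn_coneExtend_cell (hF : RespectsWalls n (k.val + 1) α β F)
    (h : Admissible k α) (h' : Admissible k β) :
    ContinuousOn (coneExtend k α β F) (cell k α) := by
  refine ContinuousOn.congr (f := fun x => dilate (apex k β) (coneGauge k α x) (F (project k α x)))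
    ?_ fun x hx => coneExtend_of_mem hx
  intro x hx
  have hgc : ContinuousWithinAt (coneGauge k α) (cell k α) x :=
    (continuous_coneGauge k α).continuousWithinAt
  rcases (h.coneGauge_nonneg hx).eq_or_lt with hg | hg
  · unfold ContinuousWithinAt
    have hg0 : Filter.Tendsto (coneGauge k α) (nhdsWithin x (cell k α)) (nhds 0) := by
      rw [hg]; exact hgc
    beta_reduce
    rw [← hg, dilate_zero, tendsto_pi_nhds]
    intro i
    rw [tendsto_iff_dist_tendsto_zero]
    refine squeeze_zero' (Filter.Eventually.of_forall fun _ => dist_nonneg) ?_ hg0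
    filter_upwards [self_mem_nhdsWithin] with y hy
    simp only [dilate, Real.dist_eq, add_sub_cancel_left]
    rw [abs_mul, abs_of_nonneg (h.coneGauge_nonneg hy)]
    rcases (h.coneGauge_nonneg hy).eq_or_lt with hg' | hg'
    · simp [← hg']
    · exact mul_le_of_le_one_right hg'.le (abs_sub_le_one_of_mem_chamber
        (hF.image_project h hy hg').1.1 h'.apex_mem.1 i)
  · have hmem : cell k α ∩ {y | 0 < coneGauge k α y} ∈ nhdsWithin x (cell k α) :=
      Filter.inter_mem self_mem_nhdsWithin (hgc.eventually (lt_mem_nhds hg))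
    refine ContinuousWithinAt.mono_of_mem_nhdsWithin ?_ hmem
    have hgc' : ContinuousWithinAt (coneGauge k α) (cell k α ∩ {y | 0 < coneGauge k α y}) x :=
      hgc.mono Set.inter_subset_left
    have hp : ContinuousWithinAt (project k α) (cell k α ∩ {y | 0 < coneGauge k α y}) x := by
      rw [continuousWithinAt_pi]
      intro i
      exact continuousWithinAt_const.add ((hgc'.inv₀ hg.ne').mul
        ((continuous_apply i).continuousWithinAt.sub continuousWithinAt_const))
    have hm : Set.MapsTo (project k α) (cell k α ∩ {y | 0 < coneGauge k α y})
        (region n (k.val + 1) α) := fun y hy =>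
      have hp := h.project_mem hy.1 hy.2
      region_succ_of_base hp.1 hp.2
    have hFp : ContinuousWithinAt (fun y => F (project k α y))
        (cell k α ∩ {y | 0 < coneGauge k α y}) x :=
      (hF.cont _ (hm ⟨hx, hg⟩)).comp hp hm
    rw [continuousWithinAt_pi] at hFp ⊢
    intro i
    exact continuousWithinAt_const.add (hgc'.mul ((hFp i).sub continuousWithinAt_const))

lemma RespectsWalls.coneExtend (hF : RespectsWalls n (k.val + 1) α β F)
    (h : Admissible k α) (h' : Admissible k β) :
    RespectsWalls n k.val α β (coneExtend k α β F) := by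
  have key : ∀ x ∈ region n k.val α, x ∈ region n (k.val + 1) α ∨
      (x ∈ cell k α ∧ x 0 ≠ 0 ∧ α < x k) := fun x hx => by
    rcases (region_eq k α ▸ hx : x ∈ region n (k.val + 1) α ∪ cell k α) with hr | hc
    · exact Or.inl hr
    · by_cases hb : x 0 = 0 ∨ x k = α
      · exact Or.inl (region_succ_of_base hc hb)
      · push Not at hb
        exact Or.inr ⟨hc, hb.1, lt_of_le_of_ne hc.2.2 hb.2.symm⟩
  refine ⟨fun x hx => ?_, fun x hx i j hij => ?_, fun x hx i hi => ?_, fun x hx i hi => ?_,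
    fun x hx h0 => ?_, ?_⟩
  · rcases key x hx with hr | ⟨hc, -, -⟩
    · rw [h.coneExtend_eq hr]; exact hF.mem x hr
    · exact (hF.coneExtend_mem_cell h h' hc).1
  · rcases key x hx with hr | ⟨hc, -, hk⟩
    · rw [h.coneExtend_eq hr]; exact hF.eq x hr i j hij
    · have hap : ∀ γ, apex k γ i = apex k γ j := by
        intro γ
        rcases lt_or_ge i k with hi | hi <;> rcases lt_or_ge j k with hj | hj
        · rw [apex_of_lt hi, apex_of_lt hj]
        · linarith [hc.2.1 i hi, hc.1.2 hj]
        · linarith [hc.2.1 j hj, hc.1.2 hi]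
        · rw [apex_of_le hi, apex_of_le hj]
      rw [coneExtend_of_mem hc]
      rcases (h.coneGauge_nonneg hc).eq_or_lt with hg | hg
      · rw [← hg, dilate_zero, hap]
      · have hp := h.project_mem hc hg
        have := hF.eq _ (region_succ_of_base hp.1 hp.2) i j
          (by simp only [project, dilate, hij, hap])
        simp only [dilate, this, hap]
  · rcases key x hx with hr | ⟨hc, -, hk⟩
    · rw [h.coneExtend_eq hr]; exact hF.le x hr i hi
    · rcases lt_or_ge i k with hik | hik
      · exact (hF.coneExtend_mem_cell h h' hc).2.1 i hik
      · linarith [hc.1.2 hik]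
  · rcases key x hx with hr | ⟨hc, -, hk⟩
    · rw [h.coneExtend_eq hr]; exact hF.ge x hr i hi
    · rcases lt_or_ge i k with hik | hik
      · have hxi : x i = α := le_antisymm (hc.2.1 i hik) hi
        rw [coneExtend_of_mem hc]
        rcases (h.coneGauge_nonneg hc).eq_or_lt with hg | hg
        · rw [← hg, dilate_zero, apex_of_lt hik]
        · have hp := h.project_mem hc hg
          have := hF.ge _ (region_succ_of_base hp.1 hp.2) i
            (by simp [project, dilate, hxi, apex_of_lt hik])
          simp only [dilate, apex_of_lt hik]
          linarith [mul_nonneg hg.le (sub_nonneg.2 this)]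
      · exact cell_ge (hF.coneExtend_mem_cell h h' hc) hik
  · rcases key x hx with hr | ⟨-, h1, -⟩
    · rw [h.coneExtend_eq hr]; exact hF.zero x hr h0
    · exact absurd h0 h1
  · rw [region_eq]
    exact (hF.cont.congr fun x hx => h.coneExtend_eq hx).union_of_isClosed
      (hF.continuousOn_coneExtend_cell h h') (isClosed_region _ _ _) (isClosed_cell _ _)

lemma RespectsWalls.mem_region {m : ℕ} (hF : RespectsWalls n m α β F) (hx : x ∈ region n m α) :
    F x ∈ region n m β :=
  ⟨hF.mem x hx, hx.2.imp (hF.zero x hx) fun h i hi => hF.le x hx i (h i hi)⟩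

lemma RespectsWalls.coneExtend_leftInv (hF : RespectsWalls n (k.val + 1) α β F)
    (h : Admissible k α) (h' : Admissible k β)
    (hGF : ∀ x ∈ region n (k.val + 1) α, G (F x) = x) :
    ∀ x ∈ region n k.val α, _root_.coneExtend k β α G (_root_.coneExtend k α β F x) = x := by
  intro x hx
  rcases (region_eq k α ▸ hx : x ∈ region n (k.val + 1) α ∪ cell k α) with hr | hc
  · rw [h.coneExtend_eq hr, h'.coneExtend_eq (hF.mem_region hr), hGF x hr]
  · rw [coneExtend_of_mem (hF.coneExtend_mem_cell h h' hc), coneExtend_of_mem hc]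
    rcases (h.coneGauge_nonneg hc).eq_or_lt with hg | hg
    · rw [← hg, dilate_zero, h'.coneGauge_apex, dilate_zero, h.eq_apex hc hg.symm.le]
    · have hp := h.project_mem hc hg
      have hi := hF.image_project h hc hg
      have hgz : coneGauge k β (dilate (apex k β) (coneGauge k α x) (F (project k α x)))
          = coneGauge k α x := by
        rw [h'.coneGauge_dilate _ hg.le, h'.coneGauge_eq_one hi.1 hi.2, mul_one]
      have hpz : project k β (dilate (apex k β) (coneGauge k α x) (F (project k α x)))
          = F (project k α x) := by
        rw [project, hgz, dilate_inv_dilate _ _ hg.ne']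
      rw [hgz, hpz, hGF _ (region_succ_of_base hp.1 hp.2),
        h.dilate_project hc]

end Cone

section Extension

variable {n : ℕ} {α β : ℝ} {F G : (Fin (n+1) → ℝ) → (Fin (n+1) → ℝ)}

lemma exists_extension_to_chamber (m : ℕ) (hm : m ≤ n + 1)
    (hα : ∀ k : Fin (n+1), k.val < m → Admissible k α)
    (hβ : ∀ k : Fin (n+1), k.val < m → Admissible k β)
    (hF : RespectsWalls n m α β F) (hG : RespectsWalls n m β α G)
    (hGF : ∀ x ∈ region n m α, G (F x) = x) (hFG : ∀ x ∈ region n m β, F (G x) = x) :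
    ∃ F' G', RespectsWalls n 0 α β F' ∧ RespectsWalls n 0 β α G' ∧
      (∀ x ∈ region n 0 α, G' (F' x) = x) ∧ (∀ x ∈ region n 0 β, F' (G' x) = x) ∧
      ∀ x ∈ region n m α, F' x = F x := by
  induction m generalizing F G with
  | zero => exact ⟨F, G, hF, hG, hGF, hFG, fun _ _ => rfl⟩
  | succ m ih =>
    obtain ⟨k, rfl⟩ : ∃ k : Fin (n+1), k.val = m := ⟨⟨m, hm⟩, rfl⟩
    have a := hα k (Nat.lt_succ_self _)
    have b := hβ k (Nat.lt_succ_self _)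
    obtain ⟨F', G', h1, h2, h3, h4, h5⟩ := ih k.isLt.le (fun i hi => hα i (hi.trans (Nat.lt_succ_self _)))
      (fun i hi => hβ i (hi.trans (Nat.lt_succ_self _))) (hF.coneExtend a b) (hG.coneExtend b a)
      (hF.coneExtend_leftInv a b hGF) (hG.coneExtend_leftInv b a hFG)
    refine ⟨F', G', h1, h2, h3, h4, fun x hx => ?_⟩
    rw [h5 x (region_eq k α ▸ Or.inl hx), a.coneExtend_eq hx]

/-- The permutation-equivariant map which agrees with `F` on the chamber. -/
def symmetrize (F : (Fin (n+1) → ℝ) → (Fin (n+1) → ℝ)) (x : Fin (n+1) → ℝ) : Fin (n+1) → ℝ :=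
  F (x ∘ Tuple.sort x) ∘ (Tuple.sort x).symm

lemma comp_perm_mem_region {x : Fin (n+1) → ℝ} (hx : x ∈ stdSimplex ℝ (Fin (n+1)))
    {σ : Equiv.Perm (Fin (n+1))} (hσ : Monotone (x ∘ σ)) : x ∘ σ ∈ region n 0 α :=
  ⟨⟨perm_mem σ hx, hσ⟩, Or.inr fun _ hi => absurd hi (Nat.not_lt_zero _)⟩

lemma RespectsWalls.symmetrize_eq (hF : RespectsWalls n 0 α β F) {x : Fin (n+1) → ℝ}
    (hx : x ∈ stdSimplex ℝ (Fin (n+1))) {σ : Equiv.Perm (Fin (n+1))} (hσ : Monotone (x ∘ σ)) :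
    symmetrize F x = F (x ∘ σ) ∘ σ.symm := by
  have hs : x ∘ σ = x ∘ Tuple.sort x := Tuple.comp_sort_eq_comp_iff_monotone.2 hσ
  funext i
  simp only [symmetrize, ← hs, Function.comp_apply]
  refine hF.eq _ (comp_perm_mem_region hx hσ) _ _ ?_
  rw [congrFun hs]
  simp

lemma RespectsWalls.symmetrize_mem (hF : RespectsWalls n 0 α β F) {x : Fin (n+1) → ℝ}
    (hx : x ∈ stdSimplex ℝ (Fin (n+1))) : symmetrize F x ∈ stdSimplex ℝ (Fin (n+1)) :=
  perm_mem _ (hF.mem _ (comp_perm_mem_region hx (Tuple.monotone_sort x))).1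

lemma RespectsWalls.symmetrize_leftInv (hF : RespectsWalls n 0 α β F)
    (hG : RespectsWalls n 0 β α G) (hGF : ∀ x ∈ region n 0 α, G (F x) = x)
    {x : Fin (n+1) → ℝ} (hx : x ∈ stdSimplex ℝ (Fin (n+1))) :
    symmetrize G (symmetrize F x) = x := by
  have hr := comp_perm_mem_region (α := α) hx (Tuple.monotone_sort x)
  have hc : symmetrize F x ∘ Tuple.sort x = F (x ∘ Tuple.sort x) := by
    funext i; simp [symmetrize]
  rw [hG.symmetrize_eq (hF.symmetrize_mem hx) (σ := Tuple.sort x) (hc ▸ (hF.mem _ hr).2), hc,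
    hGF _ hr]
  funext i; simp

lemma symmetrize_apply (F : (Fin (n+1) → ℝ) → (Fin (n+1) → ℝ))
    (x : Fin (n+1) → ℝ) (i : Fin (n+1)) :
    symmetrize F x (Tuple.sort x i) = F (x ∘ Tuple.sort x) i := by
  simp [symmetrize]

lemma RespectsWalls.symmetrize_perm (hF : RespectsWalls n 0 α β F) {x : Fin (n+1) → ℝ}
    (hx : x ∈ stdSimplex ℝ (Fin (n+1))) (ϑ : Equiv.Perm (Fin (n+1))) :
    symmetrize F (fun i => x (ϑ i)) = fun i => symmetrize F x (ϑ i) := by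
  have hc : (fun i => x (ϑ i)) ∘ ((Tuple.sort x).trans ϑ.symm) = x ∘ Tuple.sort x := by
    funext i; simp
  rw [hF.symmetrize_eq (perm_mem ϑ hx) (σ := (Tuple.sort x).trans ϑ.symm)
    (hc ▸ Tuple.monotone_sort x), hc]
  rfl

lemma RespectsWalls.symmetrize_mono (hF : RespectsWalls n 0 α β F) {x : Fin (n+1) → ℝ}
    (hx : x ∈ stdSimplex ℝ (Fin (n+1))) {i j : Fin (n+1)} (hij : x i ≤ x j) :
    symmetrize F x i ≤ symmetrize F x j := by
  have hr := comp_perm_mem_region (α := α) hx (Tuple.monotone_sort x)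
  obtain ⟨a, rfl⟩ := (Tuple.sort x).surjective i
  obtain ⟨b, rfl⟩ := (Tuple.sort x).surjective j
  rw [symmetrize_apply, symmetrize_apply]
  rcases le_total a b with hab | hab
  · exact (hF.mem _ hr).2 hab
  · exact (hF.eq _ hr a b (le_antisymm hij (Tuple.monotone_sort x hab))).le

lemma RespectsWalls.symmetrize_cross (hF : RespectsWalls n 0 α β F) {x : Fin (n+1) → ℝ}
    (hx : x ∈ stdSimplex ℝ (Fin (n+1))) {j : Fin (n+1)} (hj : x j = α) :
    symmetrize F x j = β := by
  have hr := comp_perm_mem_region (α := α) hx (Tuple.monotone_sort x)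
  obtain ⟨a, rfl⟩ := (Tuple.sort x).surjective j
  rw [symmetrize_apply]
  exact le_antisymm (hF.le _ hr a hj.le) (hF.ge _ hr a hj.ge)

lemma continuous_comp_perm (σ : Equiv.Perm (Fin (n+1))) :
    Continuous fun x : Fin (n+1) → ℝ => x ∘ σ :=
  continuous_pi fun i => continuous_apply (σ i)

lemma RespectsWalls.continuous_symmetrize (hF : RespectsWalls n 0 α β F) :
    Continuous fun x : Spx (n+1) => symmetrize F x.1 := by
  refine (locallyFinite_of_finite
    (fun σ : Equiv.Perm (Fin (n+1)) => {x : Spx (n+1) | Monotone (x.1 ∘ σ)})).continuous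
    ?_ (fun σ => ?_) fun σ => ?_
  · exact Set.eq_univ_of_forall fun x => Set.mem_iUnion.2 ⟨Tuple.sort x.1, Tuple.monotone_sort x.1⟩
  · exact isClosed_monotone.preimage ((continuous_comp_perm σ).comp continuous_subtype_val)
  · refine ContinuousOn.congr (f := fun x : Spx (n+1) => F (x.1 ∘ σ) ∘ σ.symm) ?_
      fun x hx => hF.symmetrize_eq x.2 hx
    have h1 : ContinuousOn (fun x : Spx (n+1) => F (x.1 ∘ σ))
        {x : Spx (n+1) | Monotone (x.1 ∘ σ)} :=
      hF.cont.comp ((continuous_comp_perm σ).comp continuous_subtype_val).continuousOn fun x hx =>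
        comp_perm_mem_region x.2 hx
    exact (continuous_comp_perm σ.symm).comp_continuousOn h1

/-- The homeomorphism of the simplex obtained by symmetrizing a homeomorphism of the chamber. -/
def symmetrizeHomeo (hF : RespectsWalls n 0 α β F) (hG : RespectsWalls n 0 β α G)
    (hGF : ∀ x ∈ region n 0 α, G (F x) = x) (hFG : ∀ x ∈ region n 0 β, F (G x) = x) :
    Spx (n+1) ≃ₜ Spx (n+1) where
  toFun x := ⟨symmetrize F x.1, hF.symmetrize_mem x.2⟩
  invFun x := ⟨symmetrize G x.1, hG.symmetrize_mem x.2⟩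
  left_inv x := Subtype.ext (hF.symmetrize_leftInv hG hGF x.2)
  right_inv x := Subtype.ext (hG.symmetrize_leftInv hF hFG x.2)
  continuous_toFun := hF.continuous_symmetrize.subtype_mk _
  continuous_invFun := hG.continuous_symmetrize.subtype_mk _

end Extension

section Boundary

variable {n : ℕ} {α β : ℝ}

lemma ComfortOn.apply_eq {S T : Set (Spx (n+1))} {φ : ↥S → ↥T} (hφ : ComfortOn φ) (x : ↥S)
    {i j : Fin (n+1)} (h : x.1.1 i = x.1.1 j) : (φ x).1.1 i = (φ x).1.1 j :=
  le_antisymm (hφ.2 x i j h.le) (hφ.2 x j i h.ge)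

lemma ComfortOn.apply_eq_zero {φ : ↥(bou n) → ↥(bou n)} (hφ : ComfortOn φ) (x : ↥(bou n))
    {i : Fin (n+1)} (h : x.1.1 i = 0) : (φ x).1.1 i = 0 := by
  obtain ⟨j, hj⟩ := (φ x).2
  refine le_antisymm ?_ ((φ x).1.2.1 i)
  rw [← hj]
  exact hφ.2 x i j (h.trans_le (x.1.2.1 j))

lemma perm_mem_bou (ϑ : Equiv.Perm (Fin (n+1))) (x : ↥(bou n)) :
    (⟨fun i => x.1.1 (ϑ i), perm_mem ϑ x.1.2⟩ : Spx (n+1)) ∈ bou n := by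
  obtain ⟨j, hj⟩ := x.2
  exact ⟨ϑ.symm j, by simpa using hj⟩

lemma ComfortOn.symm {φ : ↥(bou n) ≃ₜ ↥(bou n)} (hφ : ComfortOn ⇑φ) : ComfortOn ⇑φ.symm := by
  have hperm : ∀ (ϑ : Equiv.Perm (Fin (n+1))) (x : ↥(bou n)),
      φ.symm ⟨_, perm_mem_bou ϑ x⟩ = ⟨_, perm_mem_bou ϑ (φ.symm x)⟩ := by
    intro ϑ x
    rw [Homeomorph.symm_apply_eq]
    apply Subtype.ext
    apply Subtype.ext
    rw [hφ.1 ϑ (φ.symm x) (perm_mem_bou ϑ (φ.symm x)), φ.apply_symm_apply]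
  refine ⟨fun ϑ x h => by rw [hperm ϑ x], fun x i j hij => ?_⟩
  by_contra! hlt
  have hji := hφ.2 (φ.symm x) j i hlt.le
  rw [φ.apply_symm_apply] at hji
  have he := le_antisymm hij hji
  have hsw : (⟨⟨fun l => x.1.1 (Equiv.swap i j l), perm_mem _ x.1.2⟩, perm_mem_bou _ x⟩ :
      ↥(bou n)) = x := by
    apply Subtype.ext
    apply Subtype.ext
    funext l
    by_cases h1 : l = i
    · simp [h1, he]
    · by_cases h2 : l = j
      · simp [h2, he]
      · simp [Equiv.swap_apply_of_ne_of_ne h1 h2]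
  have := hperm (Equiv.swap i j) x
  rw [hsw] at this
  have := congrFun (congrArg (fun y : ↥(bou n) => y.1.1) this) i
  simp only [Equiv.swap_apply_left] at this
  exact hlt.ne' this

/-- The barycenter of the face of the simplex on which the coordinates in `S` vanish. -/
def faceCenter (S : Finset (Fin (n+1))) : Fin (n+1) → ℝ :=
  fun i => if i ∈ S then 0 else ((Sᶜ.card : ℝ))⁻¹

lemma faceCenter_mem {S : Finset (Fin (n+1))} (hS : Sᶜ.Nonempty) :
    faceCenter S ∈ stdSimplex ℝ (Fin (n+1)) := by
  refine ⟨fun i => ?_, ?_⟩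
  · unfold faceCenter; split_ifs <;> positivity
  · have : (Sᶜ.card : ℝ) ≠ 0 := by exact_mod_cast hS.card_pos.ne'
    simp only [faceCenter, Finset.sum_ite, Finset.sum_const_zero, zero_add, Finset.sum_const,
      nsmul_eq_mul]
    rw [Finset.filter_not, Finset.filter_mem_eq_inter, Finset.univ_inter, ← Finset.compl_eq_univ_sdiff]
    exact mul_inv_cancel₀ this

lemma lt_inv_card {γ : ℝ} (hγ : γ < 1 / ((n:ℝ) + 1)) {T : Finset (Fin (n+1))}
    (hT : T.Nonempty) : γ < ((T.card : ℝ))⁻¹ := by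
  refine hγ.trans_le ?_
  rw [one_div]
  refine inv_anti₀ (by exact_mod_cast hT.card_pos) ?_
  exact_mod_cast (Finset.card_le_univ T).trans_eq (by simp)

lemma ComfortOn.apply_faceCenter {φ : ↥(bou n) → ↥(bou n)} (hφ : ComfortOn φ)
    {S : Finset (Fin (n+1))} (hS : Sᶜ.Nonempty) (hb : (⟨_, faceCenter_mem hS⟩ : Spx (n+1)) ∈ bou n) :
    (φ ⟨_, hb⟩).1.1 = faceCenter S := by
  set y := φ ⟨_, hb⟩
  have h0 : ∀ i ∈ S, y.1.1 i = 0 := fun i hi => hφ.apply_eq_zero _ (by simp [faceCenter, hi])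
  obtain ⟨j, hj⟩ := hS
  have h1 : ∀ i ∈ Sᶜ, y.1.1 i = y.1.1 j := fun i hi => hφ.apply_eq _ (by
    simp [faceCenter, Finset.mem_compl.1 hi, Finset.mem_compl.1 hj])
  have hs : ∑ i, y.1.1 i = Sᶜ.card * y.1.1 j := by
    rw [← Finset.sum_add_sum_compl S, Finset.sum_eq_zero h0, Finset.sum_congr rfl h1, zero_add,
      Finset.sum_const, nsmul_eq_mul]
  rw [y.1.2.2] at hs
  funext i
  by_cases hi : i ∈ S
  · rw [h0 i hi]; simp [faceCenter, hi]
  · rw [h1 i (Finset.mem_compl.2 hi), faceCenter, if_neg hi]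
    exact eq_inv_of_mul_eq_one_right hs.symm

lemma ComfortOn.level_sets {φ : ↥(bou n) ≃ₜ ↥(bou n)} (hφ : ComfortOn ⇑φ)
    (hα0 : 0 < α) (hα1 : α < 1/((n:ℝ)+1)) (hβ0 : 0 < β) (hβ1 : β < 1/((n:ℝ)+1))
    (hcross : ∀ x : ↥(bou n),
      (x : Spx (n+1)) ∈ cross n α ↔ (φ x : Spx (n+1)) ∈ cross n β)
    (x : ↥(bou n)) (S : Finset (Fin (n+1))) (hS : ∀ i ∈ S, x.1.1 i ≤ α)
    (hS' : ∀ i ∉ S, α ≤ x.1.1 i) (i : Fin (n+1)) :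
    (i ∈ S → (φ x).1.1 i ≤ β) ∧ (i ∉ S → β ≤ (φ x).1.1 i) := by
  have hne : Sᶜ.Nonempty := by
    by_contra hem
    rw [Finset.not_nonempty_iff_eq_empty, Finset.compl_eq_empty_iff] at hem
    have : ∑ i, x.1.1 i ≤ ∑ _i : Fin (n+1), α := Finset.sum_le_sum fun i _ => hS i (by simp [hem])
    rw [x.1.2.2, Finset.sum_const, Finset.card_univ, Fintype.card_fin, nsmul_eq_mul] at this
    rw [lt_div_iff₀ (by positivity)] at hα1
    push_cast at this
    linarith
  obtain ⟨j, hj⟩ := x.2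
  have hjS : j ∈ S := by
    by_contra hjS
    linarith [hS' j hjS]
  have hv := faceCenter_mem hne
  have hp : ∀ s : unitInterval, AffineMap.lineMap (k := ℝ) x.1.1 (faceCenter S) (s : ℝ)
      ∈ stdSimplex ℝ (Fin (n+1)) := fun s =>
    (convex_stdSimplex ℝ (Fin (n+1))).lineMap_mem x.1.2 hv s.2
  have hc : ∀ (s : unitInterval) l, AffineMap.lineMap (k := ℝ) x.1.1 (faceCenter S) (s : ℝ) l
      = (1 - s) * x.1.1 l + s * faceCenter S l := fun s l => by
    simp [AffineMap.lineMap_apply_module]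
  have hpb : ∀ s, (⟨_, hp s⟩ : Spx (n+1)) ∈ bou n := fun s => ⟨j, by
    simp only [hc, hj, faceCenter, if_pos hjS]; ring⟩
  let p : unitInterval → ↥(bou n) := fun s => ⟨⟨_, hp s⟩, hpb s⟩
  have hpc : Continuous p := by
    refine Continuous.subtype_mk (Continuous.subtype_mk ?_ _) _
    exact AffineMap.lineMap_continuous.comp continuous_subtype_val
  have hoff : ∀ s : unitInterval, s ≠ 0 → ∀ l, (φ (p s)).1.1 l ≠ β := by
    intro s hs l hl
    obtain ⟨m, hm⟩ := (hcross (p s)).2 ⟨l, hl⟩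
    have hs0 : 0 < (s : ℝ) := unitInterval.pos_iff_ne_zero.2 hs
    have hs1 : (s : ℝ) ≤ 1 := s.2.2
    replace hm : (1 - s) * x.1.1 m + s * faceCenter S m = α := (hc s m).symm.trans hm
    by_cases hmS : m ∈ S
    · rw [faceCenter, if_pos hmS] at hm
      nlinarith [hS m hmS]
    · have := lt_inv_card hα1 hne
      rw [faceCenter, if_neg hmS] at hm
      nlinarith [hS' m hmS]
  have hgc : Continuous fun s => (φ (p s)).1.1 i :=
    (continuous_apply i).comp (continuous_subtype_val.comp
      (continuous_subtype_val.comp (φ.continuous.comp hpc)))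
  have hp0 : p 0 = x := by
    apply Subtype.ext; apply Subtype.ext
    simp [p]
  have hp1 : (φ (p 1)).1.1 i = faceCenter S i := by
    have : p 1 = ⟨⟨_, hv⟩, by simpa using hpb 1⟩ := by
      apply Subtype.ext; apply Subtype.ext
      simp [p]
    rw [this, hφ.apply_faceCenter hne]
  have hneq : ∀ s : unitInterval, (φ (p s)).1.1 i = β → (φ x).1.1 i = β := fun s hs => by
    by_cases h0 : s = 0
    · rwa [h0, hp0] at hs
    · exact absurd hs (hoff s h0 i)
  constructor
  · intro hi
    by_contra! hlt
    rw [faceCenter, if_pos hi] at hp1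
    obtain ⟨s, hs⟩ := mem_range_of_exists_le_of_exists_ge hgc (c := β)
      ⟨1, by rw [hp1]; exact hβ0.le⟩ ⟨0, by rw [hp0]; exact hlt.le⟩
    exact hlt.ne' (hneq s hs)
  · intro hi
    by_contra! hlt
    rw [faceCenter, if_neg hi] at hp1
    obtain ⟨s, hs⟩ := mem_range_of_exists_le_of_exists_ge hgc (c := β)
      ⟨0, by rw [hp0]; exact hlt.le⟩ ⟨1, by rw [hp1]; exact (lt_inv_card hβ1 hne).le⟩
    exact hlt.ne (hneq s hs)

/-- `φ` maps the part below (above) the level `α` below (above) the level `β`. -/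
def PreservesLevel (α β : ℝ) (φ : ↥(bou n) → ↥(bou n)) : Prop :=
  ∀ (x : ↥(bou n)) (i : Fin (n+1)),
    (x.1.1 i ≤ α → (φ x).1.1 i ≤ β) ∧ (α ≤ x.1.1 i → β ≤ (φ x).1.1 i)

lemma ComfortOn.preservesLevel {φ : ↥(bou n) ≃ₜ ↥(bou n)} (hφ : ComfortOn ⇑φ)
    (hα0 : 0 < α) (hα1 : α < 1/((n:ℝ)+1)) (hβ0 : 0 < β) (hβ1 : β < 1/((n:ℝ)+1))
    (hcross : ∀ x : ↥(bou n),
      (x : Spx (n+1)) ∈ cross n α ↔ (φ x : Spx (n+1)) ∈ cross n β) :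
    PreservesLevel α β φ := fun x i =>
  ⟨fun hi => (hφ.level_sets hα0 hα1 hβ0 hβ1 hcross x (Finset.univ.filter fun l => x.1.1 l ≤ α)
      (by simp) (fun l hl => by simp at hl; exact hl.le) i).1 (by simpa using hi),
    fun hi => (hφ.level_sets hα0 hα1 hβ0 hβ1 hcross x (Finset.univ.filter fun l => x.1.1 l < α)
      (fun l hl => by simp at hl; exact hl.le) (by simp) i).2 (by simpa using hi)⟩

lemma ComfortOn.preservesLevel_zero {φ : ↥(bou n) → ↥(bou n)} (hφ : ComfortOn φ) :
    PreservesLevel 0 0 φ := fun x i =>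
  ⟨fun hi => (hφ.apply_eq_zero x (le_antisymm hi (x.1.2.1 i))).le, fun _ => (φ x).1.2.1 i⟩

open Classical in
/-- `φ` as a map between vectors, with a junk value off the boundary. -/
def boundaryMap (φ : ↥(bou n) → ↥(bou n)) (x : Fin (n+1) → ℝ) : Fin (n+1) → ℝ :=
  if h : ∃ hx : x ∈ stdSimplex ℝ (Fin (n+1)), (⟨x, hx⟩ : Spx (n+1)) ∈ bou n then
    (φ ⟨⟨x, h.1⟩, h.2⟩).1.1 else x

lemma boundaryMap_apply (φ : ↥(bou n) → ↥(bou n)) (x : ↥(bou n)) :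
    boundaryMap φ x.1.1 = (φ x).1.1 :=
  dif_pos ⟨x.1.2, x.2⟩

lemma respectsWalls_boundaryMap {φ : ↥(bou n) → ↥(bou n)} (hc : Continuous φ)
    (hφ : ComfortOn φ) (hl : PreservesLevel α β φ) {m : ℕ}
    (hm : ∀ x ∈ region n m α, x 0 = 0) : RespectsWalls n m α β (boundaryMap φ) := by
  have lift : ∀ x ∈ region n m α, ∃ y : ↥(bou n), y.1.1 = x := fun x hx =>
    ⟨⟨⟨x, hx.1.1⟩, ⟨0, hm x hx⟩⟩, rfl⟩
  refine ⟨fun x hx => ?_, fun x hx i j hij => ?_, fun x hx i hi => ?_, fun x hx i hi => ?_,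
    fun x hx h0 => ?_, ?_⟩
  · obtain ⟨y, rfl⟩ := lift x hx
    rw [boundaryMap_apply]
    exact ⟨(φ y).1.2, fun i j hij => hφ.2 y i j (hx.1.2 hij)⟩
  · obtain ⟨y, rfl⟩ := lift x hx
    rw [boundaryMap_apply]
    exact hφ.apply_eq y hij
  · obtain ⟨y, rfl⟩ := lift x hx
    rw [boundaryMap_apply]
    exact (hl y i).1 hi
  · obtain ⟨y, rfl⟩ := lift x hx
    rw [boundaryMap_apply]
    exact (hl y i).2 hi
  · obtain ⟨y, rfl⟩ := lift x hx
    rw [boundaryMap_apply]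
    exact hφ.apply_eq_zero y h0
  · rw [continuousOn_iff_continuous_domRestrict]
    have : Continuous fun x : region n m α =>
        (φ ⟨⟨x.1, x.2.1.1⟩, ⟨0, hm x.1 x.2⟩⟩).1.1 := by fun_prop
    exact this.congr fun x => (boundaryMap_apply φ ⟨⟨x.1, x.2.1.1⟩, ⟨0, hm x.1 x.2⟩⟩).symm

lemma exists_comfort_extension {φ : ↥(bou n) ≃ₜ ↥(bou n)} (hφ : ComfortOn ⇑φ)
    (hl : PreservesLevel α β φ) (hl' : PreservesLevel β α φ.symm) {m : ℕ} (hmn : m ≤ n + 1)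
    (hα : ∀ k : Fin (n+1), k.val < m → Admissible k α)
    (hβ : ∀ k : Fin (n+1), k.val < m → Admissible k β)
    (hmα : ∀ x, x ∈ region n m α ↔ x ∈ chamber n ∧ x 0 = 0)
    (hmβ : ∀ x, x ∈ region n m β ↔ x ∈ chamber n ∧ x 0 = 0) :
    ∃ Φ : Spx (n+1) ≃ₜ Spx (n+1),
      IsComfort Φ ∧
      (∀ x : ↥(bou n), Φ (x : Spx (n+1)) = (φ x : Spx (n+1))) ∧
      ⇑Φ '' cross n α = cross n β := by
  obtain ⟨F, G, hF, hG, hGF, hFG, hext⟩ := exists_extension_to_chamber m hmn hα hβ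
    (respectsWalls_boundaryMap φ.continuous hφ hl fun x hx => ((hmα x).1 hx).2)
    (respectsWalls_boundaryMap φ.symm.continuous hφ.symm hl' fun x hx => ((hmβ x).1 hx).2)
    (fun x hx => by
      obtain ⟨y, rfl⟩ : ∃ y : ↥(bou n), y.1.1 = x :=
        ⟨⟨⟨x, hx.1.1⟩, ⟨0, ((hmα x).1 hx).2⟩⟩, rfl⟩
      rw [boundaryMap_apply, boundaryMap_apply, φ.symm_apply_apply])
    (fun x hx => by
      obtain ⟨y, rfl⟩ : ∃ y : ↥(bou n), y.1.1 = x :=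
        ⟨⟨⟨x, hx.1.1⟩, ⟨0, ((hmβ x).1 hx).2⟩⟩, rfl⟩
      rw [boundaryMap_apply, boundaryMap_apply, φ.apply_symm_apply])
  let Φ := symmetrizeHomeo hF hG hGF hFG
  have hcr : Set.MapsTo Φ (cross n α) (cross n β) := fun x ⟨j, hj⟩ =>
    ⟨j, hF.symmetrize_cross x.2 hj⟩
  have hcr' : Set.MapsTo Φ.symm (cross n β) (cross n α) := fun x ⟨j, hj⟩ =>
    ⟨j, hG.symmetrize_cross x.2 hj⟩
  refine ⟨Φ, ⟨fun ϑ x => hF.symmetrize_perm x.2 ϑ, fun x i j hij => hF.symmetrize_mono x.2 hij⟩,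
    fun x => Subtype.ext ?_, ?_⟩
  · have hs := Tuple.monotone_sort x.1.1
    have hb := perm_mem_bou (Tuple.sort x.1.1) x
    have h0 : (x.1.1 ∘ Tuple.sort x.1.1) 0 = 0 := by
      obtain ⟨j, hj⟩ := hb
      exact le_antisymm (hj ▸ hs (Fin.zero_le j)) (x.1.2.1 _)
    have hx : x.1.1 ∘ Tuple.sort x.1.1 ∈ region n m α := (hmα _).2 ⟨⟨perm_mem _ x.1.2, hs⟩, h0⟩
    have e : F (x.1.1 ∘ Tuple.sort x.1.1) = (φ x).1.1 ∘ Tuple.sort x.1.1 := by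
      rw [hext _ hx]
      exact (boundaryMap_apply φ ⟨_, hb⟩).trans (hφ.1 _ x hb)
    change symmetrize F x.1.1 = _
    rw [symmetrize, e]
    funext i; simp
  · refine Set.Subset.antisymm hcr.image_subset fun y hy => ⟨Φ.symm y, hcr' hy, ?_⟩
    exact Φ.apply_symm_apply y

lemma mem_region_top (hα : α < 1/((n:ℝ)+1)) (x : Fin (n+1) → ℝ) :
    x ∈ region n (n+1) α ↔ x ∈ chamber n ∧ x 0 = 0 := by
  refine and_congr_right fun hx => or_iff_left fun h => ?_
  have : ∑ i, x i ≤ ∑ _i : Fin (n+1), α := Finset.sum_le_sum fun i _ => h i i.isLt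
  rw [hx.1.2, Finset.sum_const, Finset.card_univ, Fintype.card_fin, nsmul_eq_mul] at this
  rw [lt_div_iff₀ (by positivity)] at hα
  push_cast at this
  linarith

lemma mem_region_one_zero (x : Fin (n+1) → ℝ) :
    x ∈ region n 1 0 ↔ x ∈ chamber n ∧ x 0 = 0 := by
  refine and_congr_right fun hx => or_iff_left_of_imp fun h => ?_
  exact le_antisymm (h 0 Nat.zero_lt_one) (hx.1.1 0)

/-- A boundary which is mapped onto a subset of the `β`-cross forces `β = 0`. -/
lemma eq_zero_of_bou_subset_cross (hn : 1 ≤ n) (hβ : β < 1/((n:ℝ)+1))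
    (h : bou n ⊆ cross n β) : β = 0 := by
  have hmem : (⟨Pi.single 0 1, single_mem_stdSimplex ℝ (0 : Fin (n+1))⟩ : Spx (n+1)) ∈ bou n := by
    refine ⟨Fin.last n, Pi.single_eq_of_ne ?_ _⟩
    exact Fin.ne_of_val_ne (by simp; lia)
  obtain ⟨j, hj⟩ := h hmem
  have h1 : 1 / ((n:ℝ) + 1) ≤ 1 := by
    rw [div_le_one (by positivity)]; linarith [(Nat.cast_nonneg n : (0:ℝ) ≤ n)]
  by_cases h0 : j = 0
  · subst h0
    simp only [Pi.single_eq_same] at hj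
    linarith
  · rw [← hj]; exact Pi.single_eq_of_ne h0 _

end Boundary

theorem boundary_comfort_homeo_extends (n : ℕ) (hn : 1 ≤ n) (α β : ℝ)
    (hα0 : 0 ≤ α) (hα1 : α < 1/((n:ℝ)+1))
    (hβ0 : 0 ≤ β) (hβ1 : β < 1/((n:ℝ)+1))
    (φ : ↥(bou n) ≃ₜ ↥(bou n)) (hφ : ComfortOn ⇑φ)
    (hcross : ∀ x : ↥(bou n),
      (x : Spx (n+1)) ∈ cross n α ↔ (φ x : Spx (n+1)) ∈ cross n β) :
    ∃ Φ : Spx (n+1) ≃ₜ Spx (n+1),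
      IsComfort Φ ∧
      (∀ x : ↥(bou n), Φ (x : Spx (n+1)) = (φ x : Spx (n+1))) ∧
      ⇑Φ '' cross n α = cross n β := by
  have hcross' : ∀ y : ↥(bou n),
      (y : Spx (n+1)) ∈ cross n β ↔ (φ.symm y : Spx (n+1)) ∈ cross n α := fun y => by
    rw [hcross, φ.apply_symm_apply]
  have hz : α = 0 → β = 0 := fun h => eq_zero_of_bou_subset_cross hn hβ1 fun y hy =>
    (hcross' ⟨y, hy⟩).2 (h ▸ (φ.symm ⟨y, hy⟩).2)
  have hz' : β = 0 → α = 0 := fun h => eq_zero_of_bou_subset_cross hn hα1 fun y hy =>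
    (hcross ⟨y, hy⟩).2 (h ▸ (φ ⟨y, hy⟩).2)
  have hn0 : (0:ℝ) < n + 1 := by positivity
  rcases hα0.eq_or_lt with h0 | hα
  · obtain rfl := h0.symm
    obtain rfl := hz rfl
    have adm : ∀ k : Fin (n+1), k.val < 1 → Admissible k 0 := fun k hk =>
      ⟨le_rfl, by simp, Or.inl (Fin.ext (Nat.lt_one_iff.1 hk))⟩
    exact exists_comfort_extension hφ hφ.preservesLevel_zero hφ.symm.preservesLevel_zero
      (Nat.le_add_left 1 n) adm adm mem_region_one_zero mem_region_one_zero
  · have hβ : 0 < β := hβ0.lt_of_ne fun h => hα.ne' (hz' h.symm)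
    exact exists_comfort_extension hφ (hφ.preservesLevel hα hα1 hβ hβ1 hcross)
      (hφ.symm.preservesLevel hβ hβ1 hα hα1 hcross') le_rfl
      (fun k _ => ⟨hα0, (lt_div_iff₀ hn0).1 hα1, Or.inr hα⟩)
      (fun k _ => ⟨hβ0, (lt_div_iff₀ hn0).1 hβ1, Or.inr hβ⟩)
      (mem_region_top hα1) (mem_region_top hβ1)

end
end
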